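/- arXiv:1901.07841 — 2 statements merged into one kernel-verified Lean document; each statement's English description precedes it below -/
import Mathlib

section
/- Comparison principle for the HJBQVI system: assume (H.1) and (H.2). If u = (u_i)_{i∈ℐ} is a bounded viscosity subsolution and v = (v_i)_{i∈ℐ} is a bounded viscosity supersolution of the HJBQVI system, then u_i(x) ≤ v_i(x) for all x ∈ ℝ^d and all i ∈ ℐ. -/
noncomputable section
open scoped BigOperators RealInnerProductSpace
open Filter Topology Matrix

namespace HJBQVI

abbrev E (d : ℕ) : Type := EuclideanSpace ℝ (Fin d)

variable {d d' M : ℕ}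

/-- Frobenius norm of a matrix. -/
def frobNorm (A : Matrix (Fin d) (Fin d') ℝ) : ℝ :=
  Real.sqrt (∑ k, ∑ l, (A k l) ^ 2)

/-- Hessian matrix of a real-valued function, via the second iterated Fréchet derivative. -/
def hess (φ : E d → ℝ) (x : E d) : Matrix (Fin d) (Fin d) ℝ :=
  Matrix.of fun i j =>
    iteratedFDeriv ℝ 2 φ x ![EuclideanSpace.single i (1 : ℝ), EuclideanSpace.single j (1 : ℝ)]

/-- Semiconcavity with constant `C`. -/
def Semiconcave (φ : E d → ℝ) (C : ℝ) : Prop :=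
  ∀ x h : E d, φ (x + h) - 2 * φ x + φ (x - h) ≤ C * ‖h‖ ^ 2

/-- Membership in `C⁰₁(ℝ^d)`: bounded, continuous, Lipschitz. -/
def InC01 (f : E d → ℝ) : Prop :=
  Continuous f ∧ (∃ C, ∀ x, |f x| ≤ C) ∧ ∃ L, ∀ x y, |f x - f y| ≤ L * ‖x - y‖

/-- Uniform boundedness of a system of functions. -/
def Bdd (u : Fin M → E d → ℝ) : Prop := ∃ C, ∀ i x, |u i x| ≤ C

/-- Coefficient data for the weakly coupled HJB operator. -/
structure HJBData (d d' M : ℕ) (𝒜 : Type) [MetricSpace 𝒜] where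
  A : Fin M → Set 𝒜
  σm : Fin M → 𝒜 → E d → Matrix (Fin d) (Fin d') ℝ
  bv : Fin M → 𝒜 → E d → E d
  cz : Fin M → 𝒜 → E d → ℝ
  runCost : Fin M → 𝒜 → E d → ℝ
  dcp : Fin M → Fin M → 𝒜 → E d → ℝ

variable {𝒜 𝒵 : Type} [MetricSpace 𝒜] [MetricSpace 𝒵]

/-- The linear operator `L^α_i(x, s, p, X)`. -/
def HJBData.L (P : HJBData d d' M 𝒜) (i : Fin M) (α : 𝒜) (x : E d)
    (s : Fin M → ℝ) (p : E d) (X : Matrix (Fin d) (Fin d) ℝ) : ℝ :=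
  - Matrix.trace (((1 : ℝ) / 2) • (P.σm i α x * (P.σm i α x)ᵀ) * X)
  - ⟪P.bv i α x, p⟫ + P.cz i α x * s i - P.runCost i α x
  - ∑ j ∈ Finset.univ.erase i, P.dcp i j α x * s j

/-- The Hamiltonian `sup_{α ∈ A_i} L^α_i`. -/
def HJBData.Ham (P : HJBData d d' M 𝒜) (i : Fin M) (x : E d)
    (s : Fin M → ℝ) (p : E d) (X : Matrix (Fin d) (Fin d) ℝ) : ℝ :=
  sSup ((fun α => P.L i α x s p X) '' P.A i)

/-- Data of the impulse intervention operator. -/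
structure ImpulseData (d M : ℕ) (𝒵 : Type) [MetricSpace 𝒵] where
  Z : Fin M → E d → Set 𝒵
  Γ : Fin M → E d → 𝒵 → E d
  K : Fin M → E d → 𝒵 → ℝ

/-- The intervention operator `(M_i u)(x) = min_{z ∈ Z_i(x)} [u_i(Γ_i(x,z)) + K_i(x,z)]`. -/
def ImpulseData.Mop (Q : ImpulseData d M 𝒵) (i : Fin M) (u : Fin M → E d → ℝ) (x : E d) : ℝ :=
  sInf ((fun z => u i (Q.Γ i x z) + Q.K i x z) '' Q.Z i x)

/-- Type of (possibly nonlocal) degenerate elliptic operators. -/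
abbrev Op (d M : ℕ) : Type :=
  Fin M → E d → (Fin M → E d → ℝ) → E d → Matrix (Fin d) (Fin d) ℝ → ℝ

/-- Viscosity subsolution (upper semicontinuous, tested from above by C² functions). -/
def IsSubsolution (F : Op d M) (u : Fin M → E d → ℝ) : Prop :=
  (∀ i, UpperSemicontinuous (u i)) ∧
  ∀ (i : Fin M) (φ : E d → ℝ), ContDiff ℝ 2 φ → ∀ x : E d,
    IsLocalMax (fun y => u i y - φ y) x → F i x u (gradient φ x) (hess φ x) ≤ 0

/-- Viscosity supersolution. -/
def IsSupersolution (F : Op d M) (u : Fin M → E d → ℝ) : Prop :=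
  (∀ i, LowerSemicontinuous (u i)) ∧
  ∀ (i : Fin M) (φ : E d → ℝ), ContDiff ℝ 2 φ → ∀ x : E d,
    IsLocalMin (fun y => u i y - φ y) x → 0 ≤ F i x u (gradient φ x) (hess φ x)

/-- Viscosity solution: continuous and both a sub- and a supersolution. -/
def IsSolution (F : Op d M) (u : Fin M → E d → ℝ) : Prop :=
  (∀ i, Continuous (u i)) ∧ IsSubsolution F u ∧ IsSupersolution F u

/-- Pure HJB operator. -/
def Fhjb (P : HJBData d d' M 𝒜) : Op d M :=
  fun i x u p X => P.Ham i x (fun j => u j x) p X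

/-- Obstacle problem operator with obstacle `Ψ`. -/
def Fob (P : HJBData d d' M 𝒜) (Ψ : Fin M → E d → ℝ) : Op d M :=
  fun i x u p X => max (P.Ham i x (fun j => u j x) p X) (u i x - Ψ i x)

/-- Penalized obstacle problem operator. -/
def FobPen (P : HJBData d d' M 𝒜) (Ψ : Fin M → E d → ℝ) (ρ : ℝ) : Op d M :=
  fun i x u p X => P.Ham i x (fun j => u j x) p X + ρ * max (u i x - Ψ i x) 0

/-- The HJBQVI operator. -/
def Fqvi (P : HJBData d d' M 𝒜) (Q : ImpulseData d M 𝒵) : Op d M :=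
  fun i x u p X => max (P.Ham i x (fun j => u j x) p X) (u i x - Q.Mop i u x)

/-- The penalized HJBQVI operator with penalty parameter `ρ`. -/
def Fpen (P : HJBData d d' M 𝒜) (Q : ImpulseData d M 𝒵) (ρ : ℝ) : Op d M :=
  fun i x u p X => P.Ham i x (fun j => u j x) p X + ρ * max (u i x - Q.Mop i u x) 0

/-- Assumption (H.1). -/
def H1 (P : HJBData d d' M 𝒜) (C lam0 : ℝ) : Prop :=
  0 < lam0 ∧
  (∀ i, (P.A i).Nonempty ∧ IsCompact (P.A i)) ∧
  ∀ i, ∀ α ∈ P.A i,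
    (∀ k l, Continuous fun x => P.σm i α x k l) ∧
    Continuous (P.bv i α) ∧ Continuous (P.cz i α) ∧ Continuous (P.runCost i α) ∧
    (∀ j, Continuous (P.dcp i j α)) ∧
    (∀ x, frobNorm (P.σm i α x) ≤ C) ∧
    (∀ x y, frobNorm (P.σm i α x - P.σm i α y) ≤ C * ‖x - y‖) ∧
    (∀ x, ‖P.bv i α x‖ ≤ C) ∧ (∀ x y, ‖P.bv i α x - P.bv i α y‖ ≤ C * ‖x - y‖) ∧
    (∀ x, |P.cz i α x| ≤ C) ∧ (∀ x y, |P.cz i α x - P.cz i α y| ≤ C * ‖x - y‖) ∧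
    (∀ x, |P.runCost i α x| ≤ C) ∧
    (∀ x y, |P.runCost i α x - P.runCost i α y| ≤ C * ‖x - y‖) ∧
    (∀ j, (∀ x, |P.dcp i j α x| ≤ C) ∧ ∀ x y, |P.dcp i j α x - P.dcp i j α y| ≤ C * ‖x - y‖) ∧
    (∀ j ∈ Finset.univ.erase i, ∀ x, 0 ≤ P.dcp i j α x) ∧
    ∀ x, lam0 ≤ P.cz i α x - ∑ j ∈ Finset.univ.erase i, P.dcp i j α x

/-- Assumption (H.2). -/
def H2 (Q : ImpulseData d M 𝒵) (κ₀ : ℝ) : Prop :=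
  0 < κ₀ ∧
  (∀ i x, (Q.Z i x).Nonempty ∧ IsCompact (Q.Z i x)) ∧
  (∀ i, Continuous fun p : E d × 𝒵 => Q.Γ i p.1 p.2) ∧
  (∀ i, Continuous fun p : E d × 𝒵 => Q.K i p.1 p.2) ∧
  (∀ (i : Fin M) (x : E d), ∀ ε > (0 : ℝ), ∃ δ > (0 : ℝ), ∀ y, dist y x < δ →
      Metric.hausdorffDist (Q.Z i x) (Q.Z i y) < ε) ∧
  ∀ i x, ∀ z ∈ Q.Z i x, κ₀ ≤ Q.K i x z

/-- Assumption (H.3): `λ₀ > sup_{i,α} ([σ^α_i]₁² + [b^α_i]₁)`. -/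
def H3 (P : HJBData d d' M 𝒜) (lam0 : ℝ) : Prop :=
  ∃ Kσ Kb : ℝ, 0 ≤ Kσ ∧ 0 ≤ Kb ∧ Kσ ^ 2 + Kb < lam0 ∧
    ∀ i, ∀ α ∈ P.A i,
      (∀ x y, frobNorm (P.σm i α x - P.σm i α y) ≤ Kσ * ‖x - y‖) ∧
      ∀ x y, ‖P.bv i α x - P.bv i α y‖ ≤ Kb * ‖x - y‖

/-- Assumption (H.4): the intervention operator preserves Lipschitz functions,
`[M_i u]₁ ≤ sup_j [u_j]₁ + C`. -/
def H4 (Q : ImpulseData d M 𝒵) (C : ℝ) : Prop :=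
  0 ≤ C ∧ ∀ u : Fin M → E d → ℝ, (∀ i, InC01 (u i)) →
    ∀ L : ℝ, 0 ≤ L → (∀ i x y, |u i x - u i y| ≤ L * ‖x - y‖) →
      ∀ i x y, |Q.Mop i u x - Q.Mop i u y| ≤ (L + C) * ‖x - y‖

/-- `C¹` regularity with bounded and Lipschitz derivative. -/
def C1Bound {F : Type} [NormedAddCommGroup F] [NormedSpace ℝ F] (f : E d → F) (C : ℝ) : Prop :=
  ContDiff ℝ 1 f ∧ (∀ x, ‖fderiv ℝ f x‖ ≤ C) ∧
    ∀ x y, ‖fderiv ℝ f x - fderiv ℝ f y‖ ≤ C * ‖x - y‖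

/-- Assumption (H.5). -/
def H5 (P : HJBData d d' M 𝒜) (C : ℝ) : Prop :=
  ∀ i, ∀ α ∈ P.A i,
    (∀ k l, C1Bound (fun x => P.σm i α x k l) C) ∧
    C1Bound (P.bv i α) C ∧ C1Bound (P.cz i α) C ∧
    (∀ j, C1Bound (P.dcp i j α) C) ∧
    Semiconcave (P.runCost i α) C

/-- Assumption (H.6): the intervention operator preserves semiconcave functions,
`[M_i u]_{2,+} ≤ sup_j [u_j]_{2,+} + C`. -/
def H6 (Q : ImpulseData d M 𝒵) (C : ℝ) : Prop :=
  0 ≤ C ∧ ∀ u : Fin M → E d → ℝ, (∀ i, Continuous (u i)) → (∃ B, ∀ i x, |u i x| ≤ B) →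
    ∀ Cu : ℝ, 0 ≤ Cu → (∀ i, Semiconcave (u i) Cu) →
      ∀ i, Semiconcave (fun x => Q.Mop i u x) (Cu + C)

/-- Switching intervention operator `(M_i u)(x) = min_{j ≠ i} [u_j(x) + k_{ij}(x)]`. -/
def Msw (k : Fin M → Fin M → E d → ℝ) (i : Fin M) (u : Fin M → E d → ℝ) (x : E d) : ℝ :=
  sInf ((fun j => u j x + k i j x) '' {j | j ≠ i})

/-- The switching HJBQVI operator. -/
def Fsw (P : HJBData d d' M 𝒜) (k : Fin M → Fin M → E d → ℝ) : Op d M :=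
  fun i x u p X => max (P.Ham i x (fun j => u j x) p X) (u i x - Msw k i u x)

/-- The componentwise penalized switching system operator. -/
def FswPen (P : HJBData d d' M 𝒜) (k : Fin M → Fin M → E d → ℝ) (ρ : ℝ) : Op d M :=
  fun i x u p X => P.Ham i x (fun j => u j x) p X
    + ρ * ∑ j ∈ Finset.univ.erase i, max (u i x - u j x - k i j x) 0

/-- Assumption (H.7) on signed switching costs. -/
def H7 (k : Fin M → Fin M → E d → ℝ) (κ₀ C : ℝ) : Prop :=
  0 < κ₀ ∧ 0 ≤ C ∧
  (∀ i x, k i i x = 0) ∧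
  (∀ i j l, j ≠ i → ∀ x : E d, κ₀ ≤ k i j x + k j l x - k i l x) ∧
  (∀ i j, (∀ x, |k i j x| ≤ C) ∧ ∀ x y, |k i j x - k i j y| ≤ C * ‖x - y‖) ∧
  ∀ i j (x : E d), k i j x < κ₀ → ∃ h₀ > (0 : ℝ), ∀ h : E d, ‖h‖ < h₀ →
    k i j (x + h) - 2 * k i j x + k i j (x - h) ≤ C * ‖h‖ ^ 2

/-- `k̃_i = min{min_{j≠i}(k_{ji} − ε), 0}`. -/
def ktil (k : Fin M → Fin M → E d → ℝ) (ε : ℝ) (i : Fin M) (x : E d) : ℝ :=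
  sInf (insert 0 ((fun j => k j i x - ε) '' {j | j ≠ i}))

/-- Strict viscosity subsolution with margin `g`: `F_i(x, u, Dφ, D²φ) ≤ g` at
every local maximum of `u_i − φ`. -/
def IsStrictSubsolution (F : Op d M) (g : ℝ) (u : Fin M → E d → ℝ) : Prop :=
  (∀ i, UpperSemicontinuous (u i)) ∧
  ∀ (i : Fin M) (φ : E d → ℝ), ContDiff ℝ 2 φ → ∀ x : E d,
    IsLocalMax (fun y => u i y - φ y) x → F i x u (gradient φ x) (hess φ x) ≤ g

/-- Half-relaxed upper limit `u*(x) = limsup_{ρ→∞, y→x} u^ρ(y)`. -/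
def relaxSup (u : ℕ → E d → ℝ) (x : E d) : ℝ :=
  Filter.limsup (fun p : ℕ × E d => u p.1 p.2) (Filter.atTop ×ˢ nhds x)

/-- Half-relaxed lower limit `u_*(x) = liminf_{ρ→∞, y→x} u^ρ(y)`. -/
def relaxInf (u : ℕ → E d → ℝ) (x : E d) : ℝ :=
  Filter.liminf (fun p : ℕ × E d => u p.1 p.2) (Filter.atTop ×ˢ nhds x)

/-- Set of optimal impulse controls `𝒵^v_i(x)`. -/
def argminSet (Q : ImpulseData d M 𝒵) (v : Fin M → E d → ℝ) (i : Fin M) (x : E d) : Set 𝒵 :=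
  {z | z ∈ Q.Z i x ∧ ∀ z' ∈ Q.Z i x,
    v i (Q.Γ i x z) + Q.K i x z ≤ v i (Q.Γ i x z') + Q.K i x z'}


/-! ### Second-order expansion of semiconvex functions near a strict maximum -/

lemma abs_sub_le_of_quadratic_modulus {ψ : ℝ → ℝ} {a K : ℝ}
    (h : ∀ s ∈ Set.Icc (0 : ℝ) 1, ∀ t ∈ Set.Icc (0 : ℝ) 1,
      -(a * |s - t|) - K * (s - t) ^ 2 ≤ ψ s - ψ t) : |ψ 1 - ψ 0| ≤ a := by
  have key : ∀ n : ℕ, |ψ 1 - ψ 0| ≤ a + K * (1 / ((n : ℝ) + 1)) := by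
    intro n
    have hn : (0 : ℝ) < (n : ℝ) + 1 := by positivity
    have hmem : ∀ k : ℕ, k ≤ n + 1 → (k : ℝ) / ((n : ℝ) + 1) ∈ Set.Icc (0 : ℝ) 1 := by
      intro k hk
      refine ⟨by positivity, ?_⟩
      rw [div_le_one hn]
      exact_mod_cast hk
    have htel := Finset.sum_range_sub (fun k : ℕ => ψ ((k : ℝ) / ((n : ℝ) + 1))) (n + 1)
    have e1 : ((n + 1 : ℕ) : ℝ) / ((n : ℝ) + 1) = 1 := by
      push_cast
      exact div_self hn.ne'
    simp only [e1, Nat.cast_zero, zero_div] at htel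
    rw [← htel]
    refine (Finset.abs_sum_le_sum_abs _ _).trans ?_
    have hstep : ∀ k ∈ Finset.range (n + 1),
        |ψ (((k + 1 : ℕ) : ℝ) / ((n : ℝ) + 1)) - ψ ((k : ℝ) / ((n : ℝ) + 1))|
          ≤ a * (1 / ((n : ℝ) + 1)) + K * (1 / ((n : ℝ) + 1)) ^ 2 := by
      intro k hk
      have hk' := Finset.mem_range.1 hk
      have m1 := hmem (k + 1) (by omega)
      have m0 := hmem k (by omega)
      have hd : ((k + 1 : ℕ) : ℝ) / ((n : ℝ) + 1) - (k : ℝ) / ((n : ℝ) + 1)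
          = 1 / ((n : ℝ) + 1) := by
        push_cast
        ring
      have hd' : (k : ℝ) / ((n : ℝ) + 1) - ((k + 1 : ℕ) : ℝ) / ((n : ℝ) + 1)
          = -(1 / ((n : ℝ) + 1)) := by
        rw [← hd]
        ring
      have h1 := h _ m1 _ m0
      have h2 := h _ m0 _ m1
      rw [hd] at h1
      rw [hd'] at h2
      have hp : |1 / ((n : ℝ) + 1)| = 1 / ((n : ℝ) + 1) := abs_of_pos (by positivity)
      rw [abs_neg, hp, neg_sq] at h2
      rw [hp] at h1
      rw [abs_le]
      constructor <;> linarith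
    refine (Finset.sum_le_sum hstep).trans (le_of_eq ?_)
    rw [Finset.sum_const, Finset.card_range, nsmul_eq_mul]
    push_cast
    field_simp
  have hlim : Tendsto (fun n : ℕ => a + K * (1 / ((n : ℝ) + 1))) atTop (𝓝 (a + K * 0)) :=
    (tendsto_one_div_add_atTop_nhds_zero_nat.const_mul K).const_add a
  simpa using ge_of_tendsto' hlim key

section SemiconvexExpansion

variable {H : Type*} [NormedAddCommGroup H] [InnerProductSpace ℝ H]

/-- `q` is a subgradient of `f` at `x` up to the concave paraboloid of opening `Λ`. -/
def HasSubgradient (f : H → ℝ) (Λ : ℝ) (x q : H) : Prop :=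
  ∀ y, f x + ⟪q, y - x⟫ - Λ / 2 * ‖y - x‖ ^ 2 ≤ f y

lemma HasSubgradient.norm_sub_le {f : H → ℝ} {Λ : ℝ} {x y q r : H}
    (hx : HasSubgradient f Λ x q) (hy : HasSubgradient f Λ y r) :
    ‖x - y‖ ≤ ‖(q + (Λ + 1) • x) - (r + (Λ + 1) • y)‖ := by
  have h1 := hx y
  have h2 := hy x
  rw [norm_sub_rev y x] at h1
  have e1 : ⟪q, y - x⟫ = -⟪q, x - y⟫ := by rw [← inner_neg_right, neg_sub]
  have e2 : ⟪(q + (Λ + 1) • x) - (r + (Λ + 1) • y), x - y⟫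
      = ⟪q, x - y⟫ - ⟪r, x - y⟫ + (Λ + 1) * ‖x - y‖ ^ 2 := by
    have : (q + (Λ + 1) • x) - (r + (Λ + 1) • y) = q - r + (Λ + 1) • (x - y) := by module
    rw [this, inner_add_left, inner_sub_left, inner_smul_left, real_inner_self_eq_norm_sq]
    simp
  have h3 := real_inner_le_norm ((q + (Λ + 1) • x) - (r + (Λ + 1) • y)) (x - y)
  rcases (norm_nonneg (x - y)).eq_or_lt with h0 | h0
  · rw [← h0]
    exact norm_nonneg _
  · refine le_of_mul_le_mul_right ?_ h0
    nlinarith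

/-- At a point where `f` is touched from above by an affine function, subgradients at other
points differ linearly. -/
lemma HasSubgradient.norm_sub_le_of_touching {f : H → ℝ} {Λ : ℝ} (hΛ : 0 < Λ) {x p y q : H}
    (hxp : HasSubgradient f Λ x p) (htouch : ∀ y, f y ≤ f x + ⟪p, y - x⟫)
    (hy : HasSubgradient f Λ y q) : ‖q - p‖ ≤ Λ * ‖y - x‖ := by
  have h1 := hxp y
  have h2 := hy (y + Λ⁻¹ • (q - p))
  have h3 := htouch (y + Λ⁻¹ • (q - p))
  rw [add_sub_cancel_left] at h2
  have e3 : y + Λ⁻¹ • (q - p) - x = (y - x) + Λ⁻¹ • (q - p) := by abel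
  rw [e3, inner_add_right] at h3
  have e4 : ⟪q, Λ⁻¹ • (q - p)⟫ - ⟪p, Λ⁻¹ • (q - p)⟫ = Λ⁻¹ * ‖q - p‖ ^ 2 := by
    rw [← inner_sub_left, inner_smul_right, real_inner_self_eq_norm_sq]
  have e5 : ‖Λ⁻¹ • (q - p)‖ ^ 2 = Λ⁻¹ ^ 2 * ‖q - p‖ ^ 2 := by
    rw [norm_smul, mul_pow, Real.norm_of_nonneg (by positivity)]
  rw [e5] at h2
  have h4 : Λ⁻¹ * ‖q - p‖ ^ 2 ≤ Λ / 2 * (Λ⁻¹ ^ 2 * ‖q - p‖ ^ 2) + Λ / 2 * ‖y - x‖ ^ 2 := by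
    linarith
  have h5 : ‖q - p‖ ^ 2 ≤ (Λ * ‖y - x‖) ^ 2 := by
    have e6 : Λ / 2 * (Λ⁻¹ ^ 2 * ‖q - p‖ ^ 2) = Λ⁻¹ * ‖q - p‖ ^ 2 / 2 := by
      field_simp
    rw [e6] at h4
    have h6 : Λ⁻¹ * ‖q - p‖ ^ 2 ≤ Λ * ‖y - x‖ ^ 2 := by linarith
    rw [inv_mul_le_iff₀ hΛ] at h6
    nlinarith
  exact le_of_sq_le_sq h5 (by positivity)

/-- A first-order expansion of the subgradients yields a second-order expansion. -/
lemma second_order_of_subgradient_expansion {f : H → ℝ} {Λ : ℝ} {x p : H} {B : H →L[ℝ] H}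
    (hsub : ∀ x, ∃ q, HasSubgradient f Λ x q)
    (hB : ∀ η > 0, ∀ᶠ y in 𝓝 x, ∀ q, HasSubgradient f Λ y q →
      ‖q - p - B (y - x)‖ ≤ η * ‖y - x‖) :
    ∀ η > 0, ∀ᶠ h in 𝓝 (0 : H),
      |f (x + h) - f x - ⟪p, h⟫ - 1 / 2 * ⟪B h, h⟫| ≤ η * ‖h‖ ^ 2 := by
  intro η hη
  obtain ⟨r, hr, hball⟩ := Metric.eventually_nhds_iff_ball.1 (hB η hη)
  refine Metric.eventually_nhds_iff_ball.2 ⟨r, hr, fun h hh => ?_⟩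
  have hhr : ‖h‖ < r := by simpa using hh
  set ψ : ℝ → ℝ := fun t => f (x + t • h) - t * ⟪p, h⟫ - 1 / 2 * t ^ 2 * ⟪B h, h⟫ with hψ
  have key : |ψ 1 - ψ 0| ≤ η * ‖h‖ ^ 2 := by
    refine abs_sub_le_of_quadratic_modulus
      (K := 1 / 2 * (Λ * ‖h‖ ^ 2 + ⟪B h, h⟫)) ?_
    intro s hs t ht
    obtain ⟨q, hq⟩ := hsub (x + t • h)
    have hth : ‖t • h‖ ≤ ‖h‖ := by
      rw [norm_smul, Real.norm_of_nonneg ht.1]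
      exact mul_le_of_le_one_left (norm_nonneg _) ht.2
    have hmem : x + t • h ∈ Metric.ball x r := by
      rw [mem_ball_iff_norm, add_sub_cancel_left]
      exact hth.trans_lt hhr
    have hq1 := hball _ hmem q hq
    rw [add_sub_cancel_left] at hq1
    have hq2 := hq (x + s • h)
    have e1 : x + s • h - (x + t • h) = (s - t) • h := by module
    rw [e1, inner_smul_right, norm_smul, mul_pow, Real.norm_eq_abs, sq_abs] at hq2
    have hin : |⟪q - p - B (t • h), h⟫| ≤ η * ‖h‖ ^ 2 := by
      refine (abs_real_inner_le_norm _ _).trans ?_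
      have := mul_le_mul_of_nonneg_right (hq1.trans (mul_le_mul_of_nonneg_left hth hη.le))
        (norm_nonneg h)
      nlinarith
    have e2 : ⟪q - p - B (t • h), h⟫ = ⟪q, h⟫ - ⟪p, h⟫ - t * ⟪B h, h⟫ := by
      rw [map_smul, inner_sub_left, inner_sub_left, inner_smul_left]
      simp
    rw [e2] at hin
    have h3 : -(η * ‖h‖ ^ 2 * |s - t|) ≤ (s - t) * (⟪q, h⟫ - ⟪p, h⟫ - t * ⟪B h, h⟫) := by
      have := neg_abs_le ((s - t) * (⟪q, h⟫ - ⟪p, h⟫ - t * ⟪B h, h⟫))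
      rw [abs_mul] at this
      have h4 := mul_le_mul_of_nonneg_left hin (abs_nonneg (s - t))
      linarith
    simp only [hψ]
    nlinarith
  convert key using 2
  simp [hψ]
  ring

variable [FiniteDimensional ℝ H]

/-- If `x` is a contact point and the inverse `J` of `x ↦ ∂f(x) + (Λ + 1) x` is differentiable at
the corresponding point, the subgradients admit a first-order expansion at `x`. -/
lemma subgradient_expansion_of_differentiable {f : H → ℝ} {Λ : ℝ} (hΛ : 0 < Λ) {x p : H}
    (hsub : ∀ x, ∃ q, HasSubgradient f Λ x q)
    (hxp : HasSubgradient f Λ x p) (htouch : ∀ y, f y ≤ f x + ⟪p, y - x⟫)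
    {S : Set H} {J : H → H} (hS : ∀ y q, HasSubgradient f Λ y q → q + (Λ + 1) • y ∈ S)
    (hJ : ∀ y q, HasSubgradient f Λ y q → J (q + (Λ + 1) • y) = y)
    (hdiff : DifferentiableWithinAt ℝ J S (p + (Λ + 1) • x)) :
    ∃ B : H →L[ℝ] H, ∀ η > 0, ∀ᶠ y in 𝓝 x, ∀ q, HasSubgradient f Λ y q →
      ‖q - p - B (y - x)‖ ≤ η * ‖y - x‖ := by
  obtain ⟨A, hA⟩ := hdiff
  have hlip : ∀ y q, HasSubgradient f Λ y q →
      ‖(q + (Λ + 1) • y) - (p + (Λ + 1) • x)‖ ≤ (2 * Λ + 1) * ‖y - x‖ := by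
    intro y q hy
    have h1 := hxp.norm_sub_le_of_touching hΛ htouch hy
    have e : (q + (Λ + 1) • y) - (p + (Λ + 1) • x) = (q - p) + (Λ + 1) • (y - x) := by module
    rw [e]
    refine (norm_add_le _ _).trans ?_
    rw [norm_smul, Real.norm_of_nonneg (by positivity)]
    linarith
  have hexp : ∀ η > 0, ∀ᶠ y in 𝓝 x, ∀ q, HasSubgradient f Λ y q →
      ‖y - x - A ((q + (Λ + 1) • y) - (p + (Λ + 1) • x))‖ ≤ η * ‖y - x‖ := by
    intro η hη
    have h2 : 0 < η / (2 * Λ + 1) := by positivity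
    have := hA.isLittleO.def h2
    rw [eventually_nhdsWithin_iff] at this
    obtain ⟨r, hr, hball⟩ := Metric.eventually_nhds_iff_ball.1 this
    refine Metric.eventually_nhds_iff_ball.2 ⟨r / (2 * Λ + 1), by positivity, ?_⟩
    intro y hy q hq
    have h3 := hlip y q hq
    rw [mem_ball_iff_norm, lt_div_iff₀ (by positivity)] at hy
    have h4 := hball (q + (Λ + 1) • y) (by rw [mem_ball_iff_norm]; linarith) (hS y q hq)
    rw [hJ y q hq, hJ x p hxp] at h4
    refine h4.trans ((mul_le_mul_of_nonneg_left h3 h2.le).trans_eq ?_)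
    field_simp
  have hsurj : Function.Surjective A := by
    have hcl : IsClosed (LinearMap.range (A : H →ₗ[ℝ] H) : Set H) :=
      Submodule.closed_of_finiteDimensional _
    intro e
    have : e ∈ closure (LinearMap.range (A : H →ₗ[ℝ] H) : Set H) := by
      rw [Metric.mem_closure_iff]
      intro ε hε
      have hη : 0 < ε / (2 * (‖e‖ + 1)) := by positivity
      have hev := hexp _ hη
      have htend : Tendsto (fun t : ℝ => x + t • e) (𝓝[>] 0) (𝓝 x) := by
        have : Continuous fun t : ℝ => x + t • e := by fun_prop
        have h0 := (this.tendsto 0).mono_left (nhdsWithin_le_nhds (s := Set.Ioi 0))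
        simpa using h0
      obtain ⟨t, ht1, ht2⟩ := ((htend.eventually hev).and self_mem_nhdsWithin).exists
      have ht : 0 < t := ht2
      obtain ⟨q, hq⟩ := hsub (x + t • e)
      have h1 := ht1 q hq
      refine ⟨A (t⁻¹ • ((q + (Λ + 1) • (x + t • e)) - (p + (Λ + 1) • x))), ⟨_, rfl⟩, ?_⟩
      rw [add_sub_cancel_left, norm_smul, Real.norm_of_nonneg ht.le] at h1
      rw [dist_eq_norm, map_smul]
      have e1 : e - t⁻¹ • A ((q + (Λ + 1) • (x + t • e)) - (p + (Λ + 1) • x))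
          = t⁻¹ • (t • e - A ((q + (Λ + 1) • (x + t • e)) - (p + (Λ + 1) • x))) := by
        rw [smul_sub, smul_smul, inv_mul_cancel₀ ht.ne', one_smul]
      rw [e1, norm_smul, Real.norm_of_nonneg (by positivity), inv_mul_lt_iff₀ ht]
      refine h1.trans_lt ?_
      have : ε / (2 * (‖e‖ + 1)) * ‖e‖ < ε := by
        rw [div_mul_eq_mul_div, div_lt_iff₀ (by positivity)]
        nlinarith [norm_nonneg e]
      nlinarith
    rw [hcl.closure_eq] at this
    exact this
  have hinj : Function.Injective A :=
    (LinearMap.injective_iff_surjective (f := (A : H →ₗ[ℝ] H))).2 hsurj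
  let D : H ≃L[ℝ] H := (LinearEquiv.ofBijective (A : H →ₗ[ℝ] H) ⟨hinj, hsurj⟩).toContinuousLinearEquiv
  have hD : ∀ y, A (D.symm y) = y := fun y => D.apply_symm_apply y
  have hD' : ∀ y, D.symm (A y) = y := fun y => D.symm_apply_apply y
  refine ⟨(D.symm : H →L[ℝ] H) - (Λ + 1) • ContinuousLinearMap.id ℝ H, fun η hη => ?_⟩
  have hpos : 0 < ‖(D.symm : H →L[ℝ] H)‖ + 1 := by positivity
  filter_upwards [hexp (η / (‖(D.symm : H →L[ℝ] H)‖ + 1)) (by positivity)] with y hy q hq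
  have e1 : q - p - ((D.symm : H →L[ℝ] H) - (Λ + 1) • ContinuousLinearMap.id ℝ H) (y - x)
      = -((D.symm : H →L[ℝ] H) (y - x - A ((q + (Λ + 1) • y) - (p + (Λ + 1) • x)))) := by
    have := hD' ((q + (Λ + 1) • y) - (p + (Λ + 1) • x))
    rw [map_sub (D.symm : H →L[ℝ] H)]
    simp only [_root_.sub_apply, _root_.smul_apply,
      ContinuousLinearMap.id_apply, ContinuousLinearEquiv.coe_coe]
    rw [this]
    module
  rw [e1, norm_neg]
  refine ((D.symm : H →L[ℝ] H).le_opNorm _).trans ?_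
  calc _ ≤ (‖(D.symm : H →L[ℝ] H)‖ + 1) * (η / (‖(D.symm : H →L[ℝ] H)‖ + 1) * ‖y - x‖) := by
        gcongr
        · linarith
        · exact hy q hq
    _ = η * ‖y - x‖ := by field_simp

/-- Jensen's lemma combined with Alexandrov's theorem: arbitrarily close to a strict maximum of a
semiconvex function there are contact points with a second-order expansion. -/
theorem exists_contact_second_order {f : H → ℝ} {Λ c δ : ℝ} (hΛ : 0 < Λ) (hc : 0 < c)
    (hδ : 0 < δ) (hf : Continuous f) (hsub : ∀ x, ∃ q, HasSubgradient f Λ x q) (x₀ : H)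
    (hmax : ∀ x, f x ≤ f x₀ - c * ‖x - x₀‖ ^ 2) :
    ∃ (x p : H) (B : H →L[ℝ] H), ‖p‖ ≤ δ ∧ ‖x - x₀‖ ≤ δ / c ∧
      (∀ y, f y ≤ f x + ⟪p, y - x⟫) ∧
      ∀ η > 0, ∀ᶠ h in 𝓝 (0 : H),
        |f (x + h) - f x - ⟪p, h⟫ - 1 / 2 * ⟪B h, h⟫| ≤ η * ‖h‖ ^ 2 := by
  classical
  have hcontact : ∀ p : H, ‖p‖ ≤ δ → ∃ x, ‖x - x₀‖ ≤ δ / c ∧ ∀ y, f y ≤ f x + ⟪p, y - x⟫ := by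
    intro p hp
    have hcont : Continuous fun x => f x - ⟪p, x⟫ := by fun_prop
    obtain ⟨x, hx, hxm⟩ := (isCompact_closedBall x₀ (δ / c)).exists_isMaxOn
      ⟨x₀, Metric.mem_closedBall_self (by positivity)⟩ hcont.continuousOn
    have h0 : f x₀ - ⟪p, x₀⟫ ≤ f x - ⟪p, x⟫ :=
      hxm (Metric.mem_closedBall_self (by positivity : 0 ≤ δ / c))
    refine ⟨x, mem_closedBall_iff_norm.1 hx, fun y => ?_⟩
    have goal : f y - ⟪p, y⟫ ≤ f x - ⟪p, x⟫ := by
      by_cases hy : y ∈ Metric.closedBall x₀ (δ / c)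
      · exact hxm hy
      · rw [mem_closedBall_iff_norm, not_le, div_lt_iff₀ hc] at hy
        refine le_trans ?_ h0
        have h1 := hmax y
        have h2 : ⟪p, x₀ - y⟫ ≤ δ * ‖y - x₀‖ := by
          refine (real_inner_le_norm _ _).trans ?_
          rw [norm_sub_rev]
          exact mul_le_mul_of_nonneg_right hp (norm_nonneg _)
        rw [inner_sub_right] at h2
        nlinarith [norm_nonneg (y - x₀)]
    rw [inner_sub_right]
    linarith
  have hgrad : ∀ x p : H, (∀ y, f y ≤ f x + ⟪p, y - x⟫) → HasSubgradient f Λ x p := by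
    intro x p h
    obtain ⟨q, hq⟩ := hsub x
    have h1 : q = p := by
      have h2 := hq (x + Λ⁻¹ • (q - p))
      have h3 := h (x + Λ⁻¹ • (q - p))
      rw [add_sub_cancel_left] at h2 h3
      have e4 : ⟪q, Λ⁻¹ • (q - p)⟫ - ⟪p, Λ⁻¹ • (q - p)⟫ = Λ⁻¹ * ‖q - p‖ ^ 2 := by
        rw [← inner_sub_left, inner_smul_right, real_inner_self_eq_norm_sq]
      have e5 : Λ / 2 * ‖Λ⁻¹ • (q - p)‖ ^ 2 = Λ⁻¹ * ‖q - p‖ ^ 2 / 2 := by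
        rw [norm_smul, mul_pow, Real.norm_of_nonneg (by positivity)]
        field_simp
      have h6 : Λ⁻¹ * ‖q - p‖ ^ 2 ≤ 0 := by linarith
      have h7 : ‖q - p‖ ^ 2 ≤ 0 := by
        rw [inv_mul_le_iff₀ hΛ] at h6
        simpa using h6
      have h8 : ‖q - p‖ = 0 := by
        have := sq_nonneg ‖q - p‖
        exact pow_eq_zero_iff two_ne_zero |>.1 (le_antisymm h7 this)
      exact sub_eq_zero.1 (norm_eq_zero.1 h8)
    rwa [← h1]
  let S : Set H := {z | ∃ y, HasSubgradient f Λ y (z - (Λ + 1) • y)}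
  let J : H → H := fun z =>
    if h : ∃ y, HasSubgradient f Λ y (z - (Λ + 1) • y) then h.choose else 0
  have hJspec : ∀ z ∈ S, HasSubgradient f Λ (J z) (z - (Λ + 1) • J z) := by
    intro z hz
    have hz' : ∃ y, HasSubgradient f Λ y (z - (Λ + 1) • y) := hz
    have : J z = hz'.choose := dif_pos hz'
    rw [this]
    exact hz'.choose_spec
  have hS : ∀ y q, HasSubgradient f Λ y q → q + (Λ + 1) • y ∈ S := by
    intro y q h
    exact ⟨y, by simpa using h⟩
  have hJ : ∀ y q, HasSubgradient f Λ y q → J (q + (Λ + 1) • y) = y := by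
    intro y q h
    have h1 := (hJspec _ (hS y q h)).norm_sub_le h
    rw [sub_add_cancel, sub_self, norm_zero] at h1
    exact sub_eq_zero.1 (norm_le_zero_iff.1 h1)
  have hJlip : LipschitzOnWith 1 J S := by
    refine LipschitzOnWith.of_dist_le_mul fun z hz z' hz' => ?_
    have h1 := (hJspec z hz).norm_sub_le (hJspec z' hz')
    rw [sub_add_cancel, sub_add_cancel] at h1
    simpa [dist_eq_norm] using h1
  let mH : MeasurableSpace H := borel H
  have bH : BorelSpace H := ⟨rfl⟩
  let μ : MeasureTheory.Measure H := MeasureTheory.Measure.hausdorffMeasure (Module.finrank ℝ H : ℝ)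
  have hae := hJlip.ae_differentiableWithinAt_of_mem (μ := μ)
  have hnull : μ {z | ¬ (z ∈ S → DifferentiableWithinAt ℝ J S z)} = 0 := hae
  let N : Set H := {z | z ∈ S ∧ ¬ DifferentiableWithinAt ℝ J S z}
  have hN : μ N = 0 := by
    refine MeasureTheory.measure_mono_null ?_ hnull
    intro z hz h
    exact hz.2 (h hz.1)
  have hex : ∃ p x, ‖p‖ ≤ δ ∧ ‖x - x₀‖ ≤ δ / c ∧ (∀ y, f y ≤ f x + ⟪p, y - x⟫) ∧
      DifferentiableWithinAt ℝ J S (p + (Λ + 1) • x) := by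
    by_contra! hcon
    have hlip : LipschitzOnWith (1 + Real.toNNReal (Λ + 1)) (fun z => z - (Λ + 1) • J z) N := by
      refine LipschitzOnWith.of_dist_le_mul fun z hz z' hz' => ?_
      have h1 := hJlip.dist_le_mul z hz.1 z' hz'.1
      rw [dist_eq_norm] at h1 ⊢
      rw [dist_eq_norm] at h1
      have e : z - (Λ + 1) • J z - (z' - (Λ + 1) • J z') = (z - z') - (Λ + 1) • (J z - J z') := by
        module
      rw [e]
      refine (norm_sub_le _ _).trans ?_
      rw [norm_smul, Real.norm_of_nonneg (by positivity), dist_eq_norm]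
      push_cast
      rw [Real.coe_toNNReal _ (by positivity)]
      simp only [NNReal.coe_one, one_mul] at h1
      nlinarith
    have himg := hlip.hausdorffMeasure_image_le (d := (Module.finrank ℝ H : ℝ)) (by positivity)
    have himg0 : μ ((fun z => z - (Λ + 1) • J z) '' N) = 0 := by
      refine le_antisymm (himg.trans ?_) zero_le
      change _ * μ N ≤ 0
      rw [hN, mul_zero]
    have hsubset : Metric.ball (0 : H) δ ⊆ (fun z => z - (Λ + 1) • J z) '' N := by
      intro p hp
      have hp' : ‖p‖ ≤ δ := (mem_ball_zero_iff.1 hp).le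
      obtain ⟨x, hx, hxm⟩ := hcontact p hp'
      have hg := hgrad x p hxm
      refine ⟨p + (Λ + 1) • x, ⟨hS x p hg, hcon p x hp' hx hxm⟩, ?_⟩
      simp only [hJ x p hg, add_sub_cancel_right]
    have hball : 0 < μ (Metric.ball (0 : H) δ) := Metric.measure_ball_pos μ 0 hδ
    exact hball.ne' (MeasureTheory.measure_mono_null hsubset himg0)
  obtain ⟨p, x, hp, hx, hxm, hd⟩ := hex
  obtain ⟨B, hB⟩ := subgradient_expansion_of_differentiable hΛ hsub (hgrad x p hxm) hxm hS hJ hd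
  exact ⟨x, p, B, hp, hx, hxm, second_order_of_subgradient_expansion hsub hB⟩

end SemiconvexExpansion

lemma continuous_of_hasSubgradient {H : Type*} [NormedAddCommGroup H] [InnerProductSpace ℝ H]
    [FiniteDimensional ℝ H] {f : H → ℝ} {Λ : ℝ} (hsub : ∀ x, ∃ q, HasSubgradient f Λ x q) :
    Continuous f := by
  have hconv : ConvexOn ℝ Set.univ fun x => f x + Λ / 2 * ‖x‖ ^ 2 := by
    refine ⟨convex_univ, fun x _ y _ a b ha hb hab => ?_⟩
    obtain ⟨q, hq⟩ := hsub (a • x + b • y)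
    have h1 := hq x
    have h2 := hq y
    have ex : x - (a • x + b • y) = b • (x - y) := by
      have : a = 1 - b := by linarith
      rw [this]
      module
    have ey : y - (a • x + b • y) = -(a • (x - y)) := by
      have : b = 1 - a := by linarith
      rw [this]
      module
    rw [ex, inner_smul_right, norm_smul, mul_pow, Real.norm_eq_abs, sq_abs,
      norm_sub_sq_real] at h1
    rw [ey, inner_neg_right, inner_smul_right, norm_neg, norm_smul, mul_pow, Real.norm_eq_abs,
      sq_abs, norm_sub_sq_real] at h2
    have en : ‖a • x + b • y‖ ^ 2
        = a ^ 2 * ‖x‖ ^ 2 + 2 * (a * (b * ⟪x, y⟫)) + b ^ 2 * ‖y‖ ^ 2 := by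
      rw [norm_add_sq_real, norm_smul, norm_smul, mul_pow, mul_pow, Real.norm_eq_abs, sq_abs,
        Real.norm_eq_abs, sq_abs, inner_smul_left, inner_smul_right]
      simp
    simp only [smul_eq_mul]
    rw [en]
    have h1' := mul_le_mul_of_nonneg_left h1 ha
    have h2' := mul_le_mul_of_nonneg_left h2 hb
    obtain rfl : b = 1 - a := by linarith
    nlinarith
  have h1 : Continuous fun x => f x + Λ / 2 * ‖x‖ ^ 2 := by
    simpa [← continuousOn_univ] using hconv.continuousOn isOpen_univ
  have h2 : f = fun x => (f x + Λ / 2 * ‖x‖ ^ 2) - Λ / 2 * ‖x‖ ^ 2 := by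
    ext x
    ring
  rw [h2]
  fun_prop

/-! ### Sup-convolution and doubling of variables -/

/-- Sup-convolution with the paraboloid of opening `a`. -/
def supConv {G : Type*} [NormedAddCommGroup G] (w : G → ℝ) (a : ℝ) (x : G) : ℝ :=
  ⨆ ξ, (w ξ - a / 2 * ‖x - ξ‖ ^ 2)

lemma le_supConv {G : Type*} [NormedAddCommGroup G] {w : G → ℝ} {R a : ℝ}
    (hR : ∀ x, |w x| ≤ R) (ha : 0 < a) (x ξ : G) :
    w ξ - a / 2 * ‖x - ξ‖ ^ 2 ≤ supConv w a x := by
  refine le_ciSup (f := fun ξ => w ξ - a / 2 * ‖x - ξ‖ ^ 2) ⟨R, ?_⟩ ξ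
  rintro _ ⟨ζ, rfl⟩
  have := (abs_le.1 (hR ζ)).2
  have : 0 ≤ a / 2 * ‖x - ζ‖ ^ 2 := by positivity
  simp only
  linarith

section Doubling

variable {G : Type*} [NormedAddCommGroup G] [InnerProductSpace ℝ G]

lemma exists_supConv_eq [FiniteDimensional ℝ G] {w : G → ℝ} {R a : ℝ}
    (hw : UpperSemicontinuous w) (hR : ∀ x, |w x| ≤ R) (ha : 0 < a) (x : G) :
    ∃ ξ, supConv w a x = w ξ - a / 2 * ‖x - ξ‖ ^ 2 := by
  have hR0 : 0 ≤ R := (abs_nonneg _).trans (hR x)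
  have : ProperSpace G := FiniteDimensional.proper ℝ G
  set r := Real.sqrt (4 * R / a) with hr
  have hr2 : r ^ 2 = 4 * R / a := Real.sq_sqrt (by positivity)
  have husc : UpperSemicontinuous fun ξ => w ξ + -(a / 2 * ‖x - ξ‖ ^ 2) :=
    hw.add (Continuous.upperSemicontinuous (by fun_prop))
  obtain ⟨ξ, -, hξ⟩ := (husc.upperSemicontinuousOn (Metric.closedBall x r)).exists_isMaxOn
    ⟨x, Metric.mem_closedBall_self (Real.sqrt_nonneg _)⟩ (isCompact_closedBall x r)
  refine ⟨ξ, le_antisymm (ciSup_le fun ζ => ?_) (le_supConv hR ha x ξ)⟩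
  by_cases hζ : ζ ∈ Metric.closedBall x r
  · have := hξ hζ
    simp only [Set.mem_ofPred_eq] at this
    linarith
  · have h0 := hξ (Metric.mem_closedBall_self (Real.sqrt_nonneg _) : x ∈ Metric.closedBall x r)
    simp only [Set.mem_ofPred_eq, sub_self, norm_zero] at h0
    rw [mem_closedBall_iff_norm', not_le] at hζ
    have h1 : r ^ 2 ≤ ‖x - ζ‖ ^ 2 := pow_le_pow_left₀ (Real.sqrt_nonneg _) hζ.le 2
    rw [hr2, div_le_iff₀ ha] at h1
    have h2 := abs_le.1 (hR x)
    have h3 := abs_le.1 (hR ζ)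
    nlinarith

lemma supConv_hasSubgradient {w : G → ℝ} {R a : ℝ} (hR : ∀ x, |w x| ≤ R) (ha : 0 < a) {x ξ : G}
    (hξ : supConv w a x = w ξ - a / 2 * ‖x - ξ‖ ^ 2) :
    HasSubgradient (supConv w a) a x (-(a • (x - ξ))) := by
  intro y
  have h1 := le_supConv hR ha y ξ
  have e : y - ξ = (x - ξ) + (y - x) := by abel
  rw [e, norm_add_sq_real] at h1
  rw [hξ, inner_neg_left, inner_smul_left]
  simp only [conj_trivial]
  linarith

/-- `w` has, up to `o(|h|²)`, the second-order expansion `(P, B)` at `ξ` from above. -/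
def HasUpperJet (w : G → ℝ) (ξ P : G) (B : G →L[ℝ] G) : Prop :=
  ∀ c > 0, ∀ᶠ h in 𝓝 (0 : G), w (ξ + h) ≤ w ξ + ⟪P, h⟫ + 1 / 2 * ⟪B h, h⟫ + c * ‖h‖ ^ 2

lemma hasUpperJet_of_supConv {w : G → ℝ} {R a : ℝ} (hR : ∀ x, |w x| ≤ R) (ha : 0 < a) {x ξ P : G}
    {B : G →L[ℝ] G} (hξ : supConv w a x = w ξ - a / 2 * ‖x - ξ‖ ^ 2)
    (h : HasUpperJet (supConv w a) x P B) : HasUpperJet w ξ P B := by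
  intro c hc
  filter_upwards [h c hc] with y hy
  have h1 := le_supConv hR ha (x + y) (ξ + y)
  rw [add_sub_add_right_eq_sub] at h1
  linarith

lemma HasUpperJet.const_mul_add {w : G → ℝ} {ξ P : G} {B : G →L[ℝ] G} (h : HasUpperJet w ξ P B)
    {t : ℝ} (ht : 0 < t) (k : ℝ) : HasUpperJet (fun x => t * w x + k) ξ (t • P) (t • B) := by
  intro c hc
  filter_upwards [h (c / t) (by positivity)] with y hy
  have h1 := mul_le_mul_of_nonneg_left hy ht.le
  have e : t * (c / t * ‖y‖ ^ 2) = c * ‖y‖ ^ 2 := by field_simp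
  simp only [_root_.smul_apply, inner_smul_left, conj_trivial]
  nlinarith

/-- The functional maximized after doubling variables and sup-convolving. -/
def doubled (w w' : G → ℝ) (a δ : ℝ) (ξ η x y : G) : ℝ :=
  w ξ + w' η - a / 2 * ‖x - ξ‖ ^ 2 - a / 2 * ‖y - η‖ ^ 2 - a / 2 * ‖x - y‖ ^ 2 - δ * ‖x‖ ^ 2

/-- Comparison of the second-order parts of two expansions at a contact point of the sum. -/
lemma quadratic_le_of_contact {W V : G → ℝ} {x y P P' : G} {B B' : G →L[ℝ] G} {a δ κ : ℝ}
    (hW : ∀ c > 0, ∀ᶠ h in 𝓝 (0 : G),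
      |W (x + h) - W x - ⟪P, h⟫ - 1 / 2 * ⟪B h, h⟫| ≤ c * ‖h‖ ^ 2)
    (hV : ∀ c > 0, ∀ᶠ h in 𝓝 (0 : G),
      |V (y + h) - V y - ⟪P', h⟫ - 1 / 2 * ⟪B' h, h⟫| ≤ c * ‖h‖ ^ 2)
    (hc : ∀ h k, W (x + h) + V (y + k) ≤ W x + V y + ⟪P, h⟫ + ⟪P', k⟫
      + a / 2 * ‖h - k‖ ^ 2 + δ * ‖h‖ ^ 2 + κ * (‖h‖ ^ 2 + ‖k‖ ^ 2)) (h k : G) :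
    ⟪B h, h⟫ + ⟪B' k, k⟫
      ≤ a * ‖h - k‖ ^ 2 + 2 * δ * ‖h‖ ^ 2 + 2 * κ * (‖h‖ ^ 2 + ‖k‖ ^ 2) := by
  refine le_of_forall_pos_le_add fun e he => ?_
  set s := ‖h‖ ^ 2 + ‖k‖ ^ 2 with hs
  have hs0 : 0 ≤ s := by positivity
  have hcpos : 0 < e / (2 * (s + 1)) := by positivity
  have tends : ∀ h : G, Tendsto (fun t : ℝ => t • h) (𝓝[>] 0) (𝓝 0) := by
    intro h
    have : Continuous fun t : ℝ => t • h := by fun_prop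
    simpa using (this.tendsto 0).mono_left (nhdsWithin_le_nhds (s := Set.Ioi 0))
  obtain ⟨t, ⟨h1, h2⟩, ht⟩ := ((((tends h).eventually (hW _ hcpos)).and
    ((tends k).eventually (hV _ hcpos))).and self_mem_nhdsWithin).exists
  have ht0 : 0 < t := ht
  have h3 := hc (t • h) (t • k)
  rw [← smul_sub] at h3
  simp only [map_smul, inner_smul_left, inner_smul_right, norm_smul, mul_pow, Real.norm_eq_abs,
    sq_abs, conj_trivial] at h1 h2 h3
  have h1' := (abs_le.1 h1).1
  have h2' := (abs_le.1 h2).1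
  have hce : e / (2 * (s + 1)) * s ≤ e / 2 := by
    rw [div_mul_eq_mul_div, div_le_div_iff₀ (by positivity) two_pos]
    nlinarith
  have h4 : t ^ 2 * (⟪B h, h⟫ + ⟪B' k, k⟫) ≤ t ^ 2 * (a * ‖h - k‖ ^ 2 + 2 * δ * ‖h‖ ^ 2
      + 2 * κ * s + 2 * (e / (2 * (s + 1)) * s)) := by
    rw [hs] at *
    nlinarith
  have h5 := le_of_mul_le_mul_left h4 (by positivity)
  linarith

/-- The doubled functional on the Hilbert product, with a quadratic perturbation. -/
def doubledReg (W V : G → ℝ) (a δ κ : ℝ) (X₀ X : WithLp 2 (G × G)) : ℝ :=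
  W X.fst + V X.snd - a / 2 * ‖X.fst - X.snd‖ ^ 2 - δ * ‖X.fst‖ ^ 2 - κ * ‖X - X₀‖ ^ 2

lemma doubledReg_hasSubgradient {W V : G → ℝ} {a δ κ : ℝ} (ha : 0 < a) (hδ : 0 ≤ δ)
    {X₀ X : WithLp 2 (G × G)} {q r : G} (hW : HasSubgradient W a X.fst q)
    (hV : HasSubgradient V a X.snd r) :
    HasSubgradient (doubledReg W V a δ κ X₀) (3 * a + 2 * δ + 2 * κ) X
      (WithLp.toLp 2 (q - a • (X.fst - X.snd) - (2 * δ) • X.fst, r + a • (X.fst - X.snd))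
        - (2 * κ) • (X - X₀)) := by
  intro Y
  obtain ⟨D, rfl⟩ : ∃ D, Y = X + D := ⟨Y - X, by abel⟩
  have h1 := hW (X + D).fst
  have h2 := hV (X + D).snd
  have e0 : X + D - X₀ = (X - X₀) + D := by abel
  have e1 : (X + D).fst = X.fst + D.fst := rfl
  have e2 : (X + D).snd = X.snd + D.snd := rfl
  have e3 : X.fst + D.fst - (X.snd + D.snd) = (X.fst - X.snd) + (D.fst - D.snd) := by abel
  have e4 : ‖D‖ ^ 2 = ‖D.fst‖ ^ 2 + ‖D.snd‖ ^ 2 := WithLp.prod_norm_sq_eq_of_L2 D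
  unfold doubledReg
  have e7 : ∀ p p' : G, ⟪WithLp.toLp 2 (p, p'), D⟫ = ⟪p, D.fst⟫ + ⟪p', D.snd⟫ := fun p p' =>
    WithLp.prod_inner_apply _ _
  rw [add_sub_cancel_left, e0, inner_sub_left, inner_smul_left, e7,
    norm_add_sq_real (X - X₀), e1, e2, e3, norm_add_sq_real (X.fst - X.snd),
    norm_add_sq_real X.fst]
  rw [e1, add_sub_cancel_left] at h1
  rw [e2, add_sub_cancel_left] at h2
  simp only [inner_sub_left, inner_add_left, inner_smul_left, inner_sub_right, conj_trivial]
  have e5 := mul_nonneg ha.le (sq_nonneg ‖D.fst + D.snd‖)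
  have e6 := mul_nonneg hδ (sq_nonneg ‖D.snd‖)
  rw [norm_add_sq_real] at e5
  rw [e4, norm_sub_sq_real D.fst]
  linarith


lemma doubledReg_add (W V : G → ℝ) (a δ κ : ℝ) (X₀ X : WithLp 2 (G × G)) (h k : G) :
    doubledReg W V a δ κ X₀ (X + WithLp.toLp 2 (h, k)) = doubledReg W V a δ κ X₀ X
      + (W (X.fst + h) - W X.fst) + (V (X.snd + k) - V X.snd)
      - ⟪a • (X.fst - X.snd) + (2 * δ) • X.fst + (2 * κ) • (X - X₀).fst, h⟫
      - ⟪(2 * κ) • (X - X₀).snd - a • (X.fst - X.snd), k⟫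
      - a / 2 * ‖h - k‖ ^ 2 - δ * ‖h‖ ^ 2 - κ * (‖h‖ ^ 2 + ‖k‖ ^ 2) := by
  have e0 : X + WithLp.toLp 2 (h, k) - X₀ = (X - X₀) + WithLp.toLp 2 (h, k) := by abel
  have e1 : (X + WithLp.toLp 2 (h, k)).fst = X.fst + h := rfl
  have e2 : (X + WithLp.toLp 2 (h, k)).snd = X.snd + k := rfl
  have e3 : X.fst + h - (X.snd + k) = (X.fst - X.snd) + (h - k) := by abel
  have e4 : ‖(WithLp.toLp 2 (h, k) : WithLp 2 (G × G))‖ ^ 2 = ‖h‖ ^ 2 + ‖k‖ ^ 2 :=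
    WithLp.prod_norm_sq_eq_of_L2 _
  have e5 : ⟪X - X₀, WithLp.toLp 2 (h, k)⟫ = ⟪(X - X₀).fst, h⟫ + ⟪(X - X₀).snd, k⟫ :=
    WithLp.prod_inner_apply _ _
  unfold doubledReg
  rw [e0, e1, e2, e3, norm_add_sq_real (X - X₀), norm_add_sq_real (X.fst - X.snd),
    norm_add_sq_real X.fst, e4, e5]
  simp only [inner_sub_left, inner_add_left, inner_smul_left, inner_sub_right, conj_trivial]
  ring

lemma expansion_of_doubledReg {W V : G → ℝ} {a δ κ : ℝ} {X₀ X p : WithLp 2 (G × G)}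
    {B : WithLp 2 (G × G) →L[ℝ] WithLp 2 (G × G)}
    (hcontact : ∀ Y, doubledReg W V a δ κ X₀ Y ≤ doubledReg W V a δ κ X₀ X + ⟪p, Y - X⟫)
    (hexp : ∀ c > 0, ∀ᶠ D in 𝓝 (0 : WithLp 2 (G × G)),
      |doubledReg W V a δ κ X₀ (X + D) - doubledReg W V a δ κ X₀ X - ⟪p, D⟫ - 1 / 2 * ⟪B D, D⟫|
        ≤ c * ‖D‖ ^ 2) :
    ∃ B₁ B₂ : G →L[ℝ] G,
      HasUpperJet W X.fst
        (p.fst + (a • (X.fst - X.snd) + (2 * δ) • X.fst + (2 * κ) • (X - X₀).fst)) B₁ ∧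
      HasUpperJet V X.snd (p.snd + ((2 * κ) • (X - X₀).snd - a • (X.fst - X.snd))) B₂ ∧
      ∀ h k, ⟪B₁ h, h⟫ + ⟪B₂ k, k⟫
        ≤ a * ‖h - k‖ ^ 2 + 2 * δ * ‖h‖ ^ 2 + 2 * κ * (‖h‖ ^ 2 + ‖k‖ ^ 2) := by
  set e := WithLp.prodContinuousLinearEquiv 2 ℝ G G with he
  set P := p.fst + (a • (X.fst - X.snd) + (2 * δ) • X.fst + (2 * κ) • (X - X₀).fst) with hP
  set P' := p.snd + ((2 * κ) • (X - X₀).snd - a • (X.fst - X.snd)) with hP'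
  have hinner : ∀ h k : G, ∀ Y : WithLp 2 (G × G), ⟪Y, WithLp.toLp 2 (h, k)⟫
      = ⟪Y.fst, h⟫ + ⟪Y.snd, k⟫ := fun h k Y => WithLp.prod_inner_apply _ _
  have hnorm : ∀ h k : G, ‖(WithLp.toLp 2 (h, k) : WithLp 2 (G × G))‖ ^ 2 = ‖h‖ ^ 2 + ‖k‖ ^ 2 :=
    fun h k => WithLp.prod_norm_sq_eq_of_L2 _
  let C₁ : G →L[ℝ] G := (ContinuousLinearMap.fst ℝ G G).comp ((e : _ →L[ℝ] _).comp
    (B.comp ((e.symm : _ →L[ℝ] _).comp (ContinuousLinearMap.inl ℝ G G))))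
  let C₂ : G →L[ℝ] G := (ContinuousLinearMap.snd ℝ G G).comp ((e : _ →L[ℝ] _).comp
    (B.comp ((e.symm : _ →L[ℝ] _).comp (ContinuousLinearMap.inr ℝ G G))))
  have hC₁ : ∀ h, C₁ h = (B (WithLp.toLp 2 (h, 0))).fst := fun h => rfl
  have hC₂ : ∀ h, C₂ h = (B (WithLp.toLp 2 (0, h))).snd := fun h => rfl
  let B₁ : G →L[ℝ] G := C₁ + (a + 2 * δ + 2 * κ) • ContinuousLinearMap.id ℝ G
  let B₂ : G →L[ℝ] G := C₂ + (a + 2 * κ) • ContinuousLinearMap.id ℝ G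
  have hB₁ : ∀ h, ⟪B₁ h, h⟫ = ⟪(B (WithLp.toLp 2 (h, 0))).fst, h⟫
      + (a + 2 * δ + 2 * κ) * ‖h‖ ^ 2 := by
    intro h
    simp only [B₁, _root_.add_apply, _root_.smul_apply, ContinuousLinearMap.id_apply, hC₁,
      inner_add_left, inner_smul_left, real_inner_self_eq_norm_sq, conj_trivial]
  have hB₂ : ∀ h, ⟪B₂ h, h⟫ = ⟪(B (WithLp.toLp 2 (0, h))).snd, h⟫ + (a + 2 * κ) * ‖h‖ ^ 2 := by
    intro h
    simp only [B₂, _root_.add_apply, _root_.smul_apply, ContinuousLinearMap.id_apply, hC₂,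
      inner_add_left, inner_smul_left, real_inner_self_eq_norm_sq, conj_trivial]
  have hcW : Continuous fun h : G => (WithLp.toLp 2 (h, 0) : WithLp 2 (G × G)) :=
    e.symm.continuous.comp (ContinuousLinearMap.inl ℝ G G).continuous
  have hcV : Continuous fun h : G => (WithLp.toLp 2 (0, h) : WithLp 2 (G × G)) :=
    e.symm.continuous.comp (ContinuousLinearMap.inr ℝ G G).continuous
  have hW : ∀ c > 0, ∀ᶠ h in 𝓝 (0 : G),
      |W (X.fst + h) - W X.fst - ⟪P, h⟫ - 1 / 2 * ⟪B₁ h, h⟫| ≤ c * ‖h‖ ^ 2 := by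
    intro c hc
    filter_upwards [(hcW.tendsto 0).eventually (hexp c hc)] with h hh
    rw [doubledReg_add, hinner, hinner, hnorm] at hh
    rw [hB₁, hP, inner_add_left p.fst]
    simp only [sub_zero, add_zero, inner_zero_right, norm_zero] at hh
    rw [zero_pow two_ne_zero, add_zero] at hh
    convert hh using 2
    ring
  have hV : ∀ c > 0, ∀ᶠ h in 𝓝 (0 : G),
      |V (X.snd + h) - V X.snd - ⟪P', h⟫ - 1 / 2 * ⟪B₂ h, h⟫| ≤ c * ‖h‖ ^ 2 := by
    intro c hc
    filter_upwards [(hcV.tendsto 0).eventually (hexp c hc)] with h hh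
    rw [doubledReg_add, hinner, hinner, hnorm] at hh
    rw [hB₂, hP', inner_add_left p.snd]
    simp only [zero_sub, norm_neg, add_zero, inner_zero_right, norm_zero] at hh
    rw [zero_pow two_ne_zero, zero_add] at hh
    convert hh using 2
    ring
  refine ⟨B₁, B₂, fun c hc => ?_, fun c hc => ?_, quadratic_le_of_contact hW hV fun h k => ?_⟩
  · filter_upwards [hW c hc] with h hh
    have := (abs_le.1 hh).2
    linarith
  · filter_upwards [hV c hc] with h hh
    have := (abs_le.1 hh).2
    linarith
  · have h1 := hcontact (X + WithLp.toLp 2 (h, k))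
    rw [doubledReg_add, add_sub_cancel_left, hinner] at h1
    rw [hP, hP', inner_add_left p.fst, inner_add_left p.snd]
    linarith

/-- Maximum principle for the sum of two semicontinuous functions: almost maximizers of the
doubled functional admitting second-order expansions from above. -/
theorem exists_doubled_jets [FiniteDimensional ℝ G] {w w' : G → ℝ} {R a δ τ : ℝ}
    (hw : UpperSemicontinuous w) (hw' : UpperSemicontinuous w') (hR : ∀ x, |w x| ≤ R)
    (hR' : ∀ x, |w' x| ≤ R) (ha : 0 < a) (hδ : 0 < δ) (hτ : 0 < τ) :
    ∃ (ξ η x y P P' : G) (B B' : G →L[ℝ] G),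
      (∀ ξ' η' x' y', doubled w w' a δ ξ' η' x' y' ≤ doubled w w' a δ ξ η x y + τ) ∧
      HasUpperJet w ξ P B ∧ HasUpperJet w' η P' B' ∧
      ‖P - (a • (x - y) + (2 * δ) • x)‖ ≤ τ ∧ ‖P' + a • (x - y)‖ ≤ τ ∧
      ∀ h k, ⟪B h, h⟫ + ⟪B' k, k⟫
        ≤ a * ‖h - k‖ ^ 2 + 2 * δ * ‖h‖ ^ 2 + τ * (‖h‖ ^ 2 + ‖k‖ ^ 2) := by
  set W := supConv w a with hWdef
  set V := supConv w' a with hVdef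
  have hWs : ∀ x, ∃ q, HasSubgradient W a x q := fun x =>
    let ⟨ξ, hξ⟩ := exists_supConv_eq hw hR ha x
    ⟨_, supConv_hasSubgradient hR ha hξ⟩
  have hVs : ∀ x, ∃ q, HasSubgradient V a x q := fun x =>
    let ⟨ξ, hξ⟩ := exists_supConv_eq hw' hR' ha x
    ⟨_, supConv_hasSubgradient hR' ha hξ⟩
  have hregs : ∀ κ X₀ X, ∃ q, HasSubgradient (doubledReg W V a δ κ X₀)
      (3 * a + 2 * δ + 2 * κ) X q := by
    intro κ X₀ X
    obtain ⟨q, hq⟩ := hWs X.fst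
    obtain ⟨r, hr⟩ := hVs X.snd
    exact ⟨_, doubledReg_hasSubgradient ha hδ.le hq hr⟩
  have hWle : ∀ x, W x ≤ R := by
    intro x
    obtain ⟨ξ, hξ⟩ := exists_supConv_eq hw hR ha x
    have := (abs_le.1 (hR ξ)).2
    have : 0 ≤ a / 2 * ‖x - ξ‖ ^ 2 := by positivity
    rw [hWdef, hξ]
    linarith
  have hVle : ∀ x, V x ≤ R := by
    intro x
    obtain ⟨ξ, hξ⟩ := exists_supConv_eq hw' hR' ha x
    have := (abs_le.1 (hR' ξ)).2
    have : 0 ≤ a / 2 * ‖x - ξ‖ ^ 2 := by positivity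
    rw [hVdef, hξ]
    linarith
  have hWge : ∀ x, -R ≤ W x := by
    intro x
    have h1 := le_supConv hR ha x x
    have := (abs_le.1 (hR x)).1
    simp only [sub_self, norm_zero] at h1
    linarith
  have hVge : ∀ x, -R ≤ V x := by
    intro x
    have h1 := le_supConv hR' ha x x
    have := (abs_le.1 (hR' x)).1
    simp only [sub_self, norm_zero] at h1
    linarith
  have hR0 : 0 ≤ R := (abs_nonneg _).trans (hR 0)
  obtain ⟨X₀, hX₀⟩ : ∃ X₀, ∀ X, doubledReg W V a δ 0 0 X ≤ doubledReg W V a δ 0 0 X₀ := by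
    have hcont := continuous_of_hasSubgradient (hregs 0 0)
    set m := min (a / 4) (δ / 3) with hm
    have hm0 : 0 < m := lt_min (by positivity) (by positivity)
    have hm1 : m ≤ a / 4 := min_le_left _ _
    have hm2 : m ≤ δ / 3 := min_le_right _ _
    set r := Real.sqrt (4 * R / m) with hr
    have hr2 : r ^ 2 = 4 * R / m := Real.sq_sqrt (by positivity)
    obtain ⟨X₀, -, hX₀⟩ := (isCompact_closedBall (0 : WithLp 2 (G × G)) r).exists_isMaxOn
      ⟨0, Metric.mem_closedBall_self (Real.sqrt_nonneg _)⟩ hcont.continuousOn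
    refine ⟨X₀, fun X => ?_⟩
    by_cases hX : X ∈ Metric.closedBall (0 : WithLp 2 (G × G)) r
    · exact hX₀ hX
    · refine le_trans ?_ (hX₀ (Metric.mem_closedBall_self (Real.sqrt_nonneg _)))
      rw [mem_closedBall_zero_iff, not_le] at hX
      have h1 : r ^ 2 ≤ ‖X‖ ^ 2 := pow_le_pow_left₀ (Real.sqrt_nonneg _) hX.le 2
      rw [hr2, div_le_iff₀ hm0, WithLp.prod_norm_sq_eq_of_L2] at h1
      have h2 : ‖X.snd‖ ^ 2 ≤ 2 * ‖X.fst‖ ^ 2 + 2 * ‖X.fst - X.snd‖ ^ 2 := by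
        have h3 : ‖X.snd‖ ≤ ‖X.fst‖ + ‖X.fst - X.snd‖ := by
          have := norm_sub_le X.fst (X.fst - X.snd)
          rwa [sub_sub_cancel] at this
        nlinarith [norm_nonneg X.snd, sq_nonneg (‖X.fst‖ - ‖X.fst - X.snd‖)]
      have h4 := hWle X.fst
      have h5 := hVle X.snd
      have h6 := hWge 0
      have h7 := hVge 0
      have e : doubledReg W V a δ 0 0 0 = W 0 + V 0 := by
        simp [doubledReg]
      rw [e]
      unfold doubledReg
      have h8 := mul_le_mul_of_nonneg_right hm1 (sq_nonneg ‖X.fst - X.snd‖)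
      have h9 := mul_le_mul_of_nonneg_right hm2 (sq_nonneg ‖X.fst‖)
      have h10 := mul_le_mul_of_nonneg_left h2 hm0.le
      linarith
  have hκ : 0 < τ / 2 := by positivity
  have hreg : ∀ X, doubledReg W V a δ (τ / 2) X₀ X
      = doubledReg W V a δ 0 0 X - τ / 2 * ‖X - X₀‖ ^ 2 := by
    intro X
    simp [doubledReg]
  have hreg₀ : doubledReg W V a δ (τ / 2) X₀ X₀ = doubledReg W V a δ 0 0 X₀ := by
    simp [doubledReg]
  obtain ⟨X, p, B, hp, hX, hcontact, hexp⟩ :=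
    exists_contact_second_order (f := doubledReg W V a δ (τ / 2) X₀)
      (Λ := 3 * a + 2 * δ + 2 * (τ / 2)) (δ := τ / 3) (by positivity) hκ (by positivity)
      (continuous_of_hasSubgradient (hregs _ _)) (hregs _ _) X₀
      (fun X => by rw [hreg, hreg₀]; linarith [hX₀ X])
  obtain ⟨B₁, B₂, hj₁, hj₂, hquad⟩ := expansion_of_doubledReg hcontact hexp
  obtain ⟨ξ, hξ⟩ := exists_supConv_eq hw hR ha X.fst
  obtain ⟨η, hη⟩ := exists_supConv_eq hw' hR' ha X.snd
  have hX' : ‖X - X₀‖ ≤ 2 / 3 := hX.trans_eq (by field_simp)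
  have hfst : ∀ Y : WithLp 2 (G × G), ‖Y.fst‖ ≤ ‖Y‖ := fun Y => by
    have := WithLp.prod_norm_sq_eq_of_L2 Y
    exact le_of_sq_le_sq (by nlinarith [sq_nonneg ‖Y.snd‖]) (norm_nonneg _)
  have hsnd : ∀ Y : WithLp 2 (G × G), ‖Y.snd‖ ≤ ‖Y‖ := fun Y => by
    have := WithLp.prod_norm_sq_eq_of_L2 Y
    exact le_of_sq_le_sq (by nlinarith [sq_nonneg ‖Y.fst‖]) (norm_nonneg _)
  refine ⟨ξ, η, X.fst, X.snd, _, _, B₁, B₂, ?_, hasUpperJet_of_supConv hR ha hξ hj₁,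
    hasUpperJet_of_supConv hR' ha hη hj₂, ?_, ?_, ?_⟩
  · intro ξ' η' x' y'
    have h1 := le_supConv hR ha x' ξ'
    have h2 := le_supConv hR' ha y' η'
    have h3 := hX₀ (WithLp.toLp 2 (x', y'))
    have h4 := hcontact X₀
    rw [hreg₀, hreg] at h4
    have h5 : ⟪p, X₀ - X⟫ ≤ τ / 3 * (2 / 3) := by
      refine (real_inner_le_norm _ _).trans ?_
      rw [norm_sub_rev]
      exact mul_le_mul hp hX' (norm_nonneg _) (by positivity)
    have h6 : 0 ≤ τ / 2 * ‖X - X₀‖ ^ 2 := by positivity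
    have e1 : doubledReg W V a δ 0 0 (WithLp.toLp 2 (x', y'))
        = W x' + V y' - a / 2 * ‖x' - y'‖ ^ 2 - δ * ‖x'‖ ^ 2 := by
      simp [doubledReg]
    have e2 : doubledReg W V a δ 0 0 X
        = W X.fst + V X.snd - a / 2 * ‖X.fst - X.snd‖ ^ 2 - δ * ‖X.fst‖ ^ 2 := by
      simp [doubledReg]
    rw [e1] at h3
    rw [e2] at h4
    unfold doubled
    linarith
  · have e : p.fst + (a • (X.fst - X.snd) + (2 * δ) • X.fst + (2 * (τ / 2)) • (X - X₀).fst)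
        - (a • (X.fst - X.snd) + (2 * δ) • X.fst) = p.fst + (2 * (τ / 2)) • (X - X₀).fst := by
      abel
    rw [e]
    refine (norm_add_le _ _).trans ?_
    rw [norm_smul, Real.norm_of_nonneg (by positivity)]
    have h1 := (hfst p).trans hp
    have h2 := (hfst (X - X₀)).trans hX'
    nlinarith
  · have e : p.snd + ((2 * (τ / 2)) • (X - X₀).snd - a • (X.fst - X.snd))
        + a • (X.fst - X.snd) = p.snd + (2 * (τ / 2)) • (X - X₀).snd := by
      abel
    rw [e]
    refine (norm_add_le _ _).trans ?_
    rw [norm_smul, Real.norm_of_nonneg (by positivity)]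
    have h1 := (hsnd p).trans hp
    have h2 := (hsnd (X - X₀)).trans hX'
    nlinarith
  · intro h k
    refine (hquad h k).trans_eq ?_
    ring

end Doubling

/-! ### Quadratic test functions -/

/-- The quadratic polynomial with gradient `p` and symmetrized Hessian form `A` at `ξ`. -/
def quadTest (ξ p : E d) (A : E d →L[ℝ] E d) (y : E d) : ℝ :=
  ⟪p, y - ξ⟫ + 1 / 2 * ⟪A (y - ξ), y - ξ⟫

lemma hasFDerivAt_quadTest (ξ p : E d) (A : E d →L[ℝ] E d) (y : E d) :
    HasFDerivAt (quadTest ξ p A) (innerSL ℝ p + ((1 / 2 : ℝ) • (innerSL ℝ).comp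
      (A + ContinuousLinearMap.adjoint A)) (y - ξ)) y := by
  have h0 : HasFDerivAt (fun y : E d => y - ξ) (ContinuousLinearMap.id ℝ (E d)) y :=
    (hasFDerivAt_id y).sub_const ξ
  have h1 := ((hasFDerivAt_const p y).inner ℝ h0).add
    (((A.hasFDerivAt.comp y h0).inner ℝ h0).const_mul (1 / 2 : ℝ))
  refine h1.congr_fderiv ?_
  ext h
  simp [ContinuousLinearMap.adjoint_inner_left, fderivInnerCLM_apply, real_inner_comm, inner_sub_left,
    inner_sub_right]
  ring

lemma contDiff_quadTest (ξ p : E d) (A : E d →L[ℝ] E d) : ContDiff ℝ 2 (quadTest ξ p A) := by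
  have h : ContDiff ℝ 2 fun y : E d => y - ξ := contDiff_id.sub contDiff_const
  exact (contDiff_const.inner ℝ h).add (contDiff_const.mul ((A.contDiff.comp h).inner ℝ h))

lemma gradient_quadTest (ξ p : E d) (A : E d →L[ℝ] E d) : gradient (quadTest ξ p A) ξ = p := by
  have h := hasFDerivAt_quadTest ξ p A ξ
  rw [sub_self, map_zero, add_zero] at h
  exact HasGradientAt.gradient (by rwa [hasGradientAt_iff_hasFDerivAt])

lemma hess_quadTest (ξ p : E d) (A : E d →L[ℝ] E d) (i j : Fin d) :
    hess (quadTest ξ p A) ξ i j =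
      1 / 2 * (⟪A (EuclideanSpace.single i 1), EuclideanSpace.single j 1⟫
        + ⟪A (EuclideanSpace.single j 1), EuclideanSpace.single i 1⟫) := by
  have h1 : fderiv ℝ (quadTest ξ p A) = fun y => innerSL ℝ p + ((1 / 2 : ℝ) • (innerSL ℝ).comp
      (A + ContinuousLinearMap.adjoint A)) (y - ξ) :=
    funext fun y => (hasFDerivAt_quadTest ξ p A y).fderiv
  have h2 : HasFDerivAt (fun y => innerSL ℝ p + ((1 / 2 : ℝ) • (innerSL ℝ).comp
      (A + ContinuousLinearMap.adjoint A)) (y - ξ)) ((1 / 2 : ℝ) • (innerSL ℝ).comp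
      (A + ContinuousLinearMap.adjoint A)) ξ :=
    ((ContinuousLinearMap.hasFDerivAt _).comp ξ ((hasFDerivAt_id ξ).sub_const ξ)).const_add _
  rw [hess, Matrix.of_apply, iteratedFDeriv_two_apply, h1, h2.fderiv]
  simp only [_root_.smul_apply, ContinuousLinearMap.comp_apply, _root_.add_apply, innerSL_apply_apply,
    inner_add_left, ContinuousLinearMap.adjoint_inner_left, smul_eq_mul, Matrix.cons_val_zero,
    Matrix.cons_val_one]
  rw [real_inner_comm (A (EuclideanSpace.single j 1))]

/-- Column `l` of a matrix, as a Euclidean vector. -/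
def col (S : Matrix (Fin d) (Fin d') ℝ) (l : Fin d') : E d := WithLp.toLp 2 fun k => S k l

lemma sum_norm_col_sq (S : Matrix (Fin d) (Fin d') ℝ) :
    ∑ l, ‖col S l‖ ^ 2 = frobNorm S ^ 2 := by
  rw [frobNorm, Real.sq_sqrt (by positivity), Finset.sum_comm]
  simp [col, EuclideanSpace.norm_sq_eq]

/-- The trace of the form `A` against `S Sᵀ`. -/
def formTrace (A : E d →L[ℝ] E d) (S : Matrix (Fin d) (Fin d') ℝ) : ℝ :=
  ∑ l, ⟪A (col S l), col S l⟫

lemma formTrace_add_smul_id (A : E d →L[ℝ] E d) (S : Matrix (Fin d) (Fin d') ℝ) (c : ℝ) :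
    formTrace (A + c • ContinuousLinearMap.id ℝ (E d)) S = formTrace A S + c * frobNorm S ^ 2 := by
  rw [← sum_norm_col_sq, Finset.mul_sum, formTrace, formTrace, ← Finset.sum_add_distrib]
  refine Finset.sum_congr rfl fun l _ => ?_
  simp [inner_add_left, inner_smul_left]

lemma formTrace_smul (A : E d →L[ℝ] E d) (S : Matrix (Fin d) (Fin d') ℝ) (t : ℝ) :
    formTrace (t • A) S = t * formTrace A S := by
  simp [formTrace, Finset.mul_sum, inner_smul_left]

lemma abs_formTrace_le (A : E d →L[ℝ] E d) (S : Matrix (Fin d) (Fin d') ℝ) :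
    |formTrace A S| ≤ ‖A‖ * frobNorm S ^ 2 := by
  rw [← sum_norm_col_sq, Finset.mul_sum, formTrace]
  refine (Finset.abs_sum_le_sum_abs _ _).trans (Finset.sum_le_sum fun l _ => ?_)
  refine (abs_real_inner_le_norm _ _).trans ?_
  rw [pow_two, ← mul_assoc]
  exact mul_le_mul_of_nonneg_right (A.le_opNorm _) (norm_nonneg _)

lemma col_eq_sum (S : Matrix (Fin d) (Fin d') ℝ) (l : Fin d') :
    col S l = ∑ k, S k l • EuclideanSpace.single k (1 : ℝ) := by
  ext k
  simp [col, Pi.single_apply]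

lemma trace_mul_hess_quadTest (ξ p : E d) (A : E d →L[ℝ] E d) (S : Matrix (Fin d) (Fin d') ℝ) :
    Matrix.trace (((1 : ℝ) / 2) • (S * Sᵀ) * hess (quadTest ξ p A) ξ) =
      1 / 2 * formTrace A S := by
  set g : Fin d → Fin d → ℝ := fun k i =>
    ⟪A (EuclideanSpace.single k 1), EuclideanSpace.single i 1⟫ with hg
  have h1 : formTrace A S = ∑ i, ∑ k, (S * Sᵀ) i k * g k i := by
    have h2 : ∀ l, ⟪A (col S l), col S l⟫ = ∑ i, ∑ k, S i l * S k l * g k i := by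
      intro l
      simp only [col_eq_sum, map_sum, map_smul, sum_inner, inner_sum, inner_smul_left,
        inner_smul_right, conj_trivial, hg, mul_assoc, Finset.mul_sum]
    simp only [formTrace, h2, Matrix.mul_apply, Matrix.transpose_apply, Finset.sum_mul]
    rw [Finset.sum_comm]
    exact Finset.sum_congr rfl fun i _ => Finset.sum_comm
  have h3 : formTrace A S = ∑ i, ∑ k, (S * Sᵀ) i k * g i k := by
    rw [h1, Finset.sum_comm]
    refine Finset.sum_congr rfl fun i _ => Finset.sum_congr rfl fun k _ => ?_
    rw [← Matrix.transpose_apply (S * Sᵀ), Matrix.transpose_mul, Matrix.transpose_transpose]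
  have h4 : Matrix.trace (((1 : ℝ) / 2) • (S * Sᵀ) * hess (quadTest ξ p A) ξ) =
      1 / 4 * (∑ i, ∑ k, (S * Sᵀ) i k * g k i + ∑ i, ∑ k, (S * Sᵀ) i k * g i k) := by
    rw [Matrix.smul_mul, Matrix.trace_smul, Matrix.trace]
    simp only [Matrix.diag_apply, Matrix.mul_apply (M := S * Sᵀ), hess_quadTest, smul_eq_mul,
      ← Finset.sum_add_distrib, Finset.mul_sum]
    refine Finset.sum_congr rfl fun i _ => Finset.sum_congr rfl fun k _ => ?_
    simp only [hg]
    ring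
  rw [h4, ← h1, ← h3]
  ring

/-- The linear operator with the second-order argument given as a quadratic form. -/
def HJBData.formL (P : HJBData d d' M 𝒜) (i : Fin M) (α : 𝒜) (x : E d)
    (s : Fin M → ℝ) (p : E d) (A : E d →L[ℝ] E d) : ℝ :=
  - (1 / 2 * formTrace A (P.σm i α x)) - ⟪P.bv i α x, p⟫ + P.cz i α x * s i - P.runCost i α x
  - ∑ j ∈ Finset.univ.erase i, P.dcp i j α x * s j

lemma HJBData.L_quadTest (P : HJBData d d' M 𝒜) (i : Fin M) (α : 𝒜) (ξ : E d)
    (s : Fin M → ℝ) (p : E d) (A : E d →L[ℝ] E d) :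
    P.L i α ξ s p (hess (quadTest ξ p A) ξ) = P.formL i α ξ s p A := by
  rw [HJBData.L, HJBData.formL, trace_mul_hess_quadTest]

lemma HJBData.formL_add_smul_id (P : HJBData d d' M 𝒜) (i : Fin M) (α : 𝒜) (ξ : E d)
    (s : Fin M → ℝ) (p : E d) (A : E d →L[ℝ] E d) (c : ℝ) :
    P.formL i α ξ s p (A + c • ContinuousLinearMap.id ℝ (E d))
      = P.formL i α ξ s p A - c / 2 * frobNorm (P.σm i α ξ) ^ 2 := by
  rw [HJBData.formL, HJBData.formL, formTrace_add_smul_id]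
  ring

lemma HasUpperJet.isLocalMax {w : E d → ℝ} {ξ p : E d} {B : E d →L[ℝ] E d}
    (h : HasUpperJet w ξ p B) {c : ℝ} (hc : 0 < c) :
    IsLocalMax (fun y => w y - quadTest ξ p (B + c • ContinuousLinearMap.id ℝ (E d)) y) ξ := by
  have hsub : Tendsto (fun y : E d => y - ξ) (𝓝 ξ) (𝓝 0) := by
    have : Continuous fun y : E d => y - ξ := by fun_prop
    simpa using this.tendsto ξ
  filter_upwards [hsub.eventually (h (c / 2) (by positivity))] with y hy
  simp only [add_sub_cancel] at hy
  simp only [quadTest, sub_self, inner_zero_right, map_zero, mul_zero, add_zero,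
    _root_.add_apply, _root_.smul_apply, ContinuousLinearMap.id_apply, inner_add_left,
    inner_smul_left, real_inner_self_eq_norm_sq, conj_trivial]
  linarith

lemma frobNorm_nonneg (S : Matrix (Fin d) (Fin d') ℝ) : 0 ≤ frobNorm S := Real.sqrt_nonneg _

lemma H1.formL_bddAbove {P : HJBData d d' M 𝒜} {C lam0 : ℝ} (h1 : H1 P C lam0) (i : Fin M)
    (ξ : E d) (s : Fin M → ℝ) (p : E d) (A : E d →L[ℝ] E d) :
    BddAbove ((fun α => P.formL i α ξ s p A) '' P.A i) := by
  refine ⟨1 / 2 * (‖A‖ * C ^ 2) + C * ‖p‖ + C * |s i| + C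
    + ∑ j ∈ Finset.univ.erase i, C * |s j|, ?_⟩
  rintro _ ⟨α, hα, rfl⟩
  obtain ⟨-, -, -, -, -, hσ, -, hb, -, hc, -, hl, -, hd, -, -⟩ := h1.2.2 i α hα
  have e1 := (neg_le_abs _).trans (abs_formTrace_le A (P.σm i α ξ))
  have e2 : ‖A‖ * frobNorm (P.σm i α ξ) ^ 2 ≤ ‖A‖ * C ^ 2 :=
    mul_le_mul_of_nonneg_left (pow_le_pow_left₀ (frobNorm_nonneg _) (hσ ξ) 2) (norm_nonneg _)
  have e3 : -⟪P.bv i α ξ, p⟫ ≤ C * ‖p‖ := (neg_le_abs _).trans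
    ((abs_real_inner_le_norm _ _).trans (mul_le_mul_of_nonneg_right (hb ξ) (norm_nonneg _)))
  have e4 : P.cz i α ξ * s i ≤ C * |s i| := (le_abs_self _).trans
    ((abs_mul _ _).le.trans (mul_le_mul_of_nonneg_right (hc ξ) (abs_nonneg _)))
  have e5 := (neg_le_abs _).trans (hl ξ)
  have e6 : -∑ j ∈ Finset.univ.erase i, P.dcp i j α ξ * s j
      ≤ ∑ j ∈ Finset.univ.erase i, C * |s j| := by
    rw [← Finset.sum_neg_distrib]
    exact Finset.sum_le_sum fun j _ => (neg_le_abs _).trans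
      ((abs_mul _ _).le.trans (mul_le_mul_of_nonneg_right ((hd j).1 ξ) (abs_nonneg _)))
  simp only [HJBData.formL]
  linarith

lemma subsolution_of_jet {P : HJBData d d' M 𝒜} {Q : ImpulseData d M 𝒵} {C lam0 κ₀ : ℝ}
    (h1 : H1 P C lam0) (h2 : H2 Q κ₀) {u : Fin M → E d → ℝ} (hub : Bdd u)
    (hsub : IsSubsolution (Fqvi P Q) u) {i : Fin M} {ξ p : E d} {B : E d →L[ℝ] E d}
    (hj : HasUpperJet (u i) ξ p B) :
    (∀ α ∈ P.A i, P.formL i α ξ (fun j => u j ξ) p B ≤ 0) ∧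
      ∀ z ∈ Q.Z i ξ, u i ξ ≤ u i (Q.Γ i ξ z) + Q.K i ξ z := by
  have key : ∀ c : ℝ, 0 < c → Fqvi P Q i ξ u p
      (hess (quadTest ξ p (B + c • ContinuousLinearMap.id ℝ (E d))) ξ) ≤ 0 := by
    intro c hc
    have h := hsub.2 i _ (contDiff_quadTest ξ p _) ξ (hj.isLocalMax hc)
    rwa [gradient_quadTest] at h
  refine ⟨fun α hα => le_of_forall_pos_le_add fun ε hε => ?_, fun z hz => ?_⟩
  · set f := frobNorm (P.σm i α ξ) ^ 2 with hf
    have hf0 : 0 ≤ f := sq_nonneg _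
    have h := (le_max_left _ _).trans (key (ε / (f + 1)) (by positivity))
    rw [HJBData.Ham] at h
    simp only [HJBData.L_quadTest] at h
    have h' := (le_csSup (h1.formL_bddAbove i ξ _ p _) (Set.mem_image_of_mem _ hα)).trans h
    simp only [HJBData.formL_add_smul_id, ← hf] at h'
    have : ε / (f + 1) / 2 * f ≤ ε := by
      rw [div_div, div_mul_eq_mul_div, div_le_iff₀ (by positivity)]
      nlinarith
    linarith
  · have h := (le_max_right _ _).trans (key 1 one_pos)
    obtain ⟨U, hU⟩ := hub
    have hb : BddBelow ((fun z => u i (Q.Γ i ξ z) + Q.K i ξ z) '' Q.Z i ξ) := by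
      refine ⟨-U + κ₀, ?_⟩
      rintro _ ⟨z, hz, rfl⟩
      exact add_le_add (abs_le.1 (hU _ _)).1 (h2.2.2.2.2.2 i ξ z hz)
    have h' := csInf_le hb (Set.mem_image_of_mem _ hz)
    rw [ImpulseData.Mop] at h
    linarith

lemma supersolution_of_jet {P : HJBData d d' M 𝒜} {Q : ImpulseData d M 𝒵} {C lam0 κ₀ : ℝ}
    (h1 : H1 P C lam0) (h2 : H2 Q κ₀) {v : Fin M → E d → ℝ}
    (hsup : IsSupersolution (Fqvi P Q) v) {i : Fin M} {η p : E d} {B : E d →L[ℝ] E d}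
    (hj : HasUpperJet (fun x => -v i x) η p B) {τ : ℝ} (hτ : 0 < τ) :
    (∃ α ∈ P.A i, -τ ≤ P.formL i α η (fun j => v j η) (-p) (-B)) ∨
      ∃ z ∈ Q.Z i η, v i (Q.Γ i η z) + Q.K i η z ≤ v i η + τ := by
  set c := τ / (C ^ 2 + 1) with hc
  have hc0 : 0 < c := by positivity
  have hmin : IsLocalMin
      (fun y => v i y - quadTest η (-p) (-(B + c • ContinuousLinearMap.id ℝ (E d))) y) η := by
    filter_upwards [hj.isLocalMax hc0] with y hy
    have e : ∀ y, quadTest η (-p) (-(B + c • ContinuousLinearMap.id ℝ (E d))) y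
        = -quadTest η p (B + c • ContinuousLinearMap.id ℝ (E d)) y := by
      intro y
      simp only [quadTest, _root_.neg_apply, inner_neg_left]
      ring
    rw [e, e]
    linarith
  have h := hsup.2 i _ (contDiff_quadTest η (-p) _) η hmin
  rw [gradient_quadTest, Fqvi, le_max_iff] at h
  refine h.imp (fun h => ?_) fun h => ?_
  · rw [HJBData.Ham] at h
    obtain ⟨_, ⟨α, hα, rfl⟩, hlt⟩ := exists_lt_of_lt_csSup ((h1.2.1 i).1.image _)
      (show -(τ / 2) < _ from lt_of_lt_of_le (by linarith) h)
    refine ⟨α, hα, ?_⟩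
    simp only [HJBData.L_quadTest] at hlt
    have e : -(B + c • ContinuousLinearMap.id ℝ (E d))
        = -B + (-c) • ContinuousLinearMap.id ℝ (E d) := by module
    rw [e, HJBData.formL_add_smul_id] at hlt
    obtain ⟨-, -, -, -, -, hσ, -⟩ := h1.2.2 i α hα
    have e2 : frobNorm (P.σm i α η) ^ 2 ≤ C ^ 2 :=
      pow_le_pow_left₀ (frobNorm_nonneg _) (hσ η) 2
    have e3 := mul_le_mul_of_nonneg_left e2 (by positivity : 0 ≤ c / 2)
    have e4 : c * (C ^ 2 + 1) = τ := by
      rw [hc]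
      field_simp
    linarith
  · rw [ImpulseData.Mop, sub_nonneg] at h
    obtain ⟨_, ⟨z, hz, rfl⟩, hlt⟩ := exists_lt_of_csInf_lt ((h2.2.1 i η).1.image _)
      (lt_of_le_of_lt h (lt_add_of_pos_right _ hτ))
    exact ⟨z, hz, hlt.le⟩

/-! ### The limit of the doubled maxima -/

lemma tendsto_zero_of_mul_norm_sq_le {G : Type*} [NormedAddCommGroup G] {f : Filter ℕ} {a : ℕ → ℝ}
    {z : ℕ → G} {T : ℝ} (ha : Tendsto a f atTop) (hz : ∀ᶠ n in f, a n * ‖z n‖ ^ 2 ≤ T) :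
    Tendsto z f (𝓝 0) := by
  have h1 : Tendsto (fun n => T / a n) f (𝓝 0) := ha.const_div_atTop T
  have h2 : Tendsto (fun n => ‖z n‖ ^ 2) f (𝓝 0) := by
    refine tendsto_of_tendsto_of_tendsto_of_le_of_le' tendsto_const_nhds h1
      (Eventually.of_forall fun n => sq_nonneg _) ?_
    filter_upwards [hz, ha.eventually_gt_atTop 0] with n hn hp
    rw [le_div_iff₀ hp]
    linarith
  have h3 := (Real.continuous_sqrt.tendsto 0).comp h2
  simp only [Real.sqrt_zero, Function.comp_def, Real.sqrt_sq (norm_nonneg _)] at h3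
  exact tendsto_zero_iff_norm_tendsto_zero.2 h3

lemma doubled_limit {G : Type*} [NormedAddCommGroup G] [InnerProductSpace ℝ G]
    [FiniteDimensional ℝ G] {w w' : G → ℝ} {R δ m : ℝ} (hw : UpperSemicontinuous w)
    (hw' : UpperSemicontinuous w') (hR : ∀ x, |w x| ≤ R) (hR' : ∀ x, |w' x| ≤ R) (hδ : 0 < δ)
    (hm : ∀ x, w x + w' x - δ * ‖x‖ ^ 2 ≤ m) {f : Ultrafilter ℕ} {a τ : ℕ → ℝ}
    {ξ η x y : ℕ → G} (ha : Tendsto a f atTop) (hτ : Tendsto τ f (𝓝 0))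
    (hD : ∀ᶠ n in (f : Filter ℕ), m - τ n ≤ doubled w w' (a n) δ (ξ n) (η n) (x n) (y n)) :
    ∃ x₀, Tendsto ξ f (𝓝 x₀) ∧ Tendsto η f (𝓝 x₀) ∧
      Tendsto (fun n => a n * ‖ξ n - η n‖ ^ 2) f (𝓝 0) ∧
      Tendsto (fun n => a n * ‖x n - y n‖ ^ 2) f (𝓝 0) := by
  set T := 2 * R - m + 1 with hT
  have hpos := ha.eventually_gt_atTop 0
  have hpen : ∀ᶠ n in (f : Filter ℕ), a n / 2 * ‖x n - ξ n‖ ^ 2 + a n / 2 * ‖y n - η n‖ ^ 2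
      + a n / 2 * ‖x n - y n‖ ^ 2 + δ * ‖x n‖ ^ 2 ≤ T := by
    filter_upwards [hD, hτ.eventually_le_const one_pos] with n h1 h2
    have h3 := (abs_le.1 (hR (ξ n))).2
    have h4 := (abs_le.1 (hR' (η n))).2
    unfold doubled at h1
    linarith
  obtain ⟨x₀, hx₀⟩ : ∃ x₀, Tendsto x f (𝓝 x₀) := by
    have hmem : ∀ᶠ n in (f : Filter ℕ), x n ∈ Metric.closedBall (0 : G) (Real.sqrt (T / δ)) := by
      filter_upwards [hpen, hpos] with n h1 h2
      rw [mem_closedBall_zero_iff]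
      refine Real.le_sqrt_of_sq_le ?_
      rw [le_div_iff₀ hδ]
      have e1 : 0 ≤ a n / 2 * ‖x n - ξ n‖ ^ 2 := by positivity
      have e2 : 0 ≤ a n / 2 * ‖y n - η n‖ ^ 2 := by positivity
      have e3 : 0 ≤ a n / 2 * ‖x n - y n‖ ^ 2 := by positivity
      linarith
    obtain ⟨x₀, -, h⟩ := (isCompact_closedBall (0 : G) (Real.sqrt (T / δ))).ultrafilter_le_nhds
      (f.map x) (by rwa [Filter.le_principal_iff])
    exact ⟨x₀, h⟩
  have hbound : ∀ g : ℕ → ℝ, (∀ n, 0 < a n → a n / 2 * g n ≤ a n / 2 * ‖x n - ξ n‖ ^ 2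
      + a n / 2 * ‖y n - η n‖ ^ 2 + a n / 2 * ‖x n - y n‖ ^ 2) →
      ∀ᶠ n in (f : Filter ℕ), a n * g n ≤ 2 * T := by
    intro g hg
    filter_upwards [hpen, hpos] with n h1 h2
    have := hg n h2
    have : 0 ≤ δ * ‖x n‖ ^ 2 := by positivity
    linarith
  have hxξ : Tendsto (fun n => x n - ξ n) f (𝓝 0) :=
    tendsto_zero_of_mul_norm_sq_le ha (hbound (fun n => ‖x n - ξ n‖ ^ 2) fun n hn => by
      have : 0 ≤ a n / 2 * ‖y n - η n‖ ^ 2 := by positivity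
      have : 0 ≤ a n / 2 * ‖x n - y n‖ ^ 2 := by positivity
      linarith)
  have hyη : Tendsto (fun n => y n - η n) f (𝓝 0) :=
    tendsto_zero_of_mul_norm_sq_le ha (hbound (fun n => ‖y n - η n‖ ^ 2) fun n hn => by
      have : 0 ≤ a n / 2 * ‖x n - ξ n‖ ^ 2 := by positivity
      have : 0 ≤ a n / 2 * ‖x n - y n‖ ^ 2 := by positivity
      linarith)
  have hxy : Tendsto (fun n => x n - y n) f (𝓝 0) :=
    tendsto_zero_of_mul_norm_sq_le ha (hbound (fun n => ‖x n - y n‖ ^ 2) fun n hn => by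
      have : 0 ≤ a n / 2 * ‖x n - ξ n‖ ^ 2 := by positivity
      have : 0 ≤ a n / 2 * ‖y n - η n‖ ^ 2 := by positivity
      linarith)
  have hξ : Tendsto ξ f (𝓝 x₀) := by simpa using hx₀.sub hxξ
  have hη : Tendsto η f (𝓝 x₀) := by simpa using (hx₀.sub hxy).sub hyη
  have hpen0 : Tendsto (fun n => a n / 2 * ‖x n - ξ n‖ ^ 2 + a n / 2 * ‖y n - η n‖ ^ 2
      + a n / 2 * ‖x n - y n‖ ^ 2) f (𝓝 0) := by
    rw [Metric.tendsto_nhds]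
    intro ε hε
    have hsq : Tendsto (fun n => δ * ‖x n‖ ^ 2) f (𝓝 (δ * ‖x₀‖ ^ 2)) :=
      (hx₀.norm.pow 2).const_mul δ
    filter_upwards [hD, hpos, hτ.eventually_lt_const (by positivity : 0 < ε / 4),
      hξ.eventually (hw x₀ (w x₀ + ε / 4) (by linarith)),
      hη.eventually (hw' x₀ (w' x₀ + ε / 4) (by linarith)),
      hsq.eventually_const_lt (by linarith : δ * ‖x₀‖ ^ 2 - ε / 4 < δ * ‖x₀‖ ^ 2)]
      with n h1 h2 h3 h4 h5 h6
    have := hm x₀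
    rw [Real.dist_eq, sub_zero, abs_of_nonneg (by positivity)]
    unfold doubled at h1
    linarith
  refine ⟨x₀, hξ, hη, ?_, ?_⟩
  · refine squeeze_zero' (hpos.mono fun n hn => by positivity) (hpos.mono fun n hn => ?_)
      (by simpa using hpen0.const_mul 6)
    have h1 : ‖ξ n - η n‖ ≤ ‖x n - ξ n‖ + ‖x n - y n‖ + ‖y n - η n‖ := by
      have e : ξ n - η n = -(x n - ξ n) + (x n - y n) + (y n - η n) := by abel
      rw [e]
      exact norm_add₃_le.trans_eq (by rw [norm_neg])
    have h2 : ‖ξ n - η n‖ ^ 2 ≤ 3 * (‖x n - ξ n‖ ^ 2 + ‖x n - y n‖ ^ 2 + ‖y n - η n‖ ^ 2) := by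
      refine (pow_le_pow_left₀ (norm_nonneg _) h1 2).trans ?_
      nlinarith [sq_nonneg (‖x n - ξ n‖ - ‖x n - y n‖), sq_nonneg (‖x n - ξ n‖ - ‖y n - η n‖),
        sq_nonneg (‖x n - y n‖ - ‖y n - η n‖)]
    have h3 := mul_le_mul_of_nonneg_left h2 hn.le
    linarith
  · refine squeeze_zero' (hpos.mono fun n hn => by positivity) (hpos.mono fun n hn => ?_)
      (by simpa using hpen0.const_mul 2)
    have : 0 ≤ a n / 2 * ‖x n - ξ n‖ ^ 2 := by positivity
    have : 0 ≤ a n / 2 * ‖y n - η n‖ ^ 2 := by positivity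
    linarith

/-- Doubled maxima for a system: the index is chosen to maximize the doubled functional. -/
lemma exists_doubled_jets_system [Nonempty (Fin M)] {w w' : Fin M → E d → ℝ} {R a δ τ : ℝ}
    (hw : ∀ j, UpperSemicontinuous (w j)) (hw' : ∀ j, UpperSemicontinuous (w' j))
    (hR : ∀ j x, |w j x| ≤ R) (hR' : ∀ j x, |w' j x| ≤ R) (ha : 0 < a) (hδ : 0 < δ) (hτ : 0 < τ) :
    ∃ (i : Fin M) (ξ η x y p p' : E d) (B B' : E d →L[ℝ] E d),
      (∀ j ξ' η' x' y', doubled (w j) (w' j) a δ ξ' η' x' y'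
        ≤ doubled (w i) (w' i) a δ ξ η x y + τ) ∧
      HasUpperJet (w i) ξ p B ∧ HasUpperJet (w' i) η p' B' ∧
      ‖p - (a • (x - y) + (2 * δ) • x)‖ ≤ τ ∧ ‖p' + a • (x - y)‖ ≤ τ ∧
      ∀ h k, ⟪B h, h⟫ + ⟪B' k, k⟫
        ≤ a * ‖h - k‖ ^ 2 + 2 * δ * ‖h‖ ^ 2 + τ * (‖h‖ ^ 2 + ‖k‖ ^ 2) := by
  choose ξ η x y p p' B B' hmax hrest using fun j =>
    exists_doubled_jets (hw j) (hw' j) (hR j) (hR' j) ha hδ hτ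
  obtain ⟨i, hi⟩ := Finite.exists_max fun j =>
    doubled (w j) (w' j) a δ (ξ j) (η j) (x j) (y j)
  exact ⟨i, ξ i, η i, x i, y i, p i, p' i, B i, B' i, fun j ξ' η' x' y' =>
    (hmax j ξ' η' x' y').trans (by linarith [hi j]), hrest i⟩

/-- The gap between the sub- and supersolution inequalities at a doubled maximum. -/
lemma H1.gap_le {P : HJBData d d' M 𝒜} {C lam0 : ℝ} (h1 : H1 P C lam0) {i : Fin M} {α : 𝒜}
    (hα : α ∈ P.A i) {s t : Fin M → ℝ} {ξ η x y p p' : E d} {B B' : E d →L[ℝ] E d}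
    {a δ τ R ρ : ℝ} (ha : 0 ≤ a) (hδ : 0 ≤ δ) (hτ : 0 ≤ τ)
    (hs : P.formL i α ξ s p B ≤ -ρ) (ht : -τ ≤ P.formL i α η t (-p') (-B'))
    (hR : ∀ j, |t j| ≤ R) (hst : ∀ j, s j - t j ≤ s i - t i + τ) (hi : 0 ≤ s i - t i)
    (hp : ‖p - (a • (x - y) + (2 * δ) • x)‖ ≤ τ) (hp' : ‖p' + a • (x - y)‖ ≤ τ)
    (hB : ∀ h k, ⟪B h, h⟫ + ⟪B' k, k⟫
        ≤ a * ‖h - k‖ ^ 2 + 2 * δ * ‖h‖ ^ 2 + τ * (‖h‖ ^ 2 + ‖k‖ ^ 2)) :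
    ρ ≤ δ * C ^ 2 + 2 * C * (δ * ‖x‖) + (1 + C ^ 2 + 2 * C + M * C) * τ
      + (C ^ 2 / 2 + C / 2) * (a * ‖ξ - η‖ ^ 2) + C / 2 * (a * ‖x - y‖ ^ 2)
      + ((M + 1) * C * R + C) * ‖ξ - η‖ := by
  obtain ⟨-, -, -, -, -, hσ, hσ', hb, hb', hc, hc', -, hl', hd, hd0, hlam⟩ := h1.2.2 i α hα
  have hC : 0 ≤ C := (abs_nonneg _).trans (hc ξ)
  have hR0 : 0 ≤ R := (abs_nonneg _).trans (hR i)
  set r := ‖ξ - η‖ with hr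
  have hr0 : 0 ≤ r := norm_nonneg _
  have second : formTrace B (P.σm i α ξ) + formTrace B' (P.σm i α η)
      ≤ a * (C ^ 2 * r ^ 2) + 2 * δ * C ^ 2 + τ * (C ^ 2 + C ^ 2) := by
    have e1 : formTrace B (P.σm i α ξ) + formTrace B' (P.σm i α η)
        ≤ a * frobNorm (P.σm i α ξ - P.σm i α η) ^ 2 + 2 * δ * frobNorm (P.σm i α ξ) ^ 2
          + τ * (frobNorm (P.σm i α ξ) ^ 2 + frobNorm (P.σm i α η) ^ 2) := by
      simp only [formTrace, ← sum_norm_col_sq, Finset.mul_sum, ← Finset.sum_add_distrib]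
      exact Finset.sum_le_sum fun l _ => hB _ _
    have e2 : frobNorm (P.σm i α ξ - P.σm i α η) ^ 2 ≤ C ^ 2 * r ^ 2 := by
      rw [← mul_pow]
      exact pow_le_pow_left₀ (frobNorm_nonneg _) (hσ' ξ η) 2
    have e3 := pow_le_pow_left₀ (frobNorm_nonneg _) (hσ ξ) 2
    have e4 := pow_le_pow_left₀ (frobNorm_nonneg _) (hσ η) 2
    refine e1.trans ?_
    gcongr
  have first : ⟪P.bv i α ξ, p⟫ + ⟪P.bv i α η, p'⟫
      ≤ a * (C * r * ‖x - y‖) + 2 * δ * (C * ‖x‖) + C * τ + C * τ := by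
    have e : ⟪P.bv i α ξ, p⟫ + ⟪P.bv i α η, p'⟫ = a * ⟪P.bv i α ξ - P.bv i α η, x - y⟫
        + 2 * δ * ⟪P.bv i α ξ, x⟫ + ⟪P.bv i α ξ, p - (a • (x - y) + (2 * δ) • x)⟫
        + ⟪P.bv i α η, p' + a • (x - y)⟫ := by
      simp only [inner_sub_left, inner_sub_right, inner_add_right, inner_smul_right]
      ring
    rw [e]
    have e1 : ⟪P.bv i α ξ - P.bv i α η, x - y⟫ ≤ C * r * ‖x - y‖ :=
      (real_inner_le_norm _ _).trans (mul_le_mul_of_nonneg_right (hb' ξ η) (norm_nonneg _))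
    have e2 : ⟪P.bv i α ξ, x⟫ ≤ C * ‖x‖ :=
      (real_inner_le_norm _ _).trans (mul_le_mul_of_nonneg_right (hb ξ) (norm_nonneg _))
    have e3 : ⟪P.bv i α ξ, p - (a • (x - y) + (2 * δ) • x)⟫ ≤ C * τ :=
      (real_inner_le_norm _ _).trans (mul_le_mul (hb ξ) hp (norm_nonneg _) hC)
    have e4 : ⟪P.bv i α η, p' + a • (x - y)⟫ ≤ C * τ :=
      (real_inner_le_norm _ _).trans (mul_le_mul (hb η) hp' (norm_nonneg _) hC)
    gcongr
  have hcross : ∀ g : E d → ℝ, (|g ξ - g η| ≤ C * r) → ∀ j, (g ξ - g η) * t j ≤ C * r * R ∧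
      -((g ξ - g η) * t j) ≤ C * r * R := by
    intro g hg j
    have e : |(g ξ - g η) * t j| ≤ C * r * R := by
      rw [abs_mul]
      exact mul_le_mul hg (hR j) (abs_nonneg _) (by positivity)
    exact ⟨(le_abs_self _).trans e, (neg_le_abs _).trans e⟩
  have coupling : ∑ j ∈ Finset.univ.erase i, P.dcp i j α ξ * s j
      - ∑ j ∈ Finset.univ.erase i, P.dcp i j α η * t j
      ≤ (∑ j ∈ Finset.univ.erase i, P.dcp i j α ξ) * (s i - t i) + M * (C * τ + C * r * R) := by
    have e1 : ∀ j ∈ Finset.univ.erase i, P.dcp i j α ξ * s j - P.dcp i j α η * t j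
        ≤ P.dcp i j α ξ * (s i - t i) + (C * τ + C * r * R) := by
      intro j hj
      have h2 := (hcross (P.dcp i j α) ((hd j).2 ξ η) j).1
      have h3 := mul_le_mul_of_nonneg_left (hst j) (hd0 j hj ξ)
      have h4 := mul_le_mul_of_nonneg_right ((le_abs_self _).trans ((hd j).1 ξ)) hτ
      linarith
    have e2 := Finset.sum_le_sum e1
    rw [Finset.sum_sub_distrib, Finset.sum_add_distrib, ← Finset.sum_mul, Finset.sum_const,
      nsmul_eq_mul] at e2
    refine e2.trans (add_le_add_right (mul_le_mul_of_nonneg_right ?_ (by positivity)) _)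
    exact_mod_cast (Finset.card_erase_le).trans_eq (by simp)
  have hci := (hcross (P.cz i α) (hc' ξ η) i).2
  have hl := (le_abs_self _).trans (hl' ξ η)
  have hdisc : 0 ≤ (P.cz i α ξ - ∑ j ∈ Finset.univ.erase i, P.dcp i j α ξ) * (s i - t i) :=
    mul_nonneg (h1.1.le.trans (hlam ξ)) hi
  have hneg : formTrace (-B') (P.σm i α η) = -formTrace B' (P.σm i α η) := by
    simp [formTrace, inner_neg_left]
  simp only [HJBData.formL, hneg, inner_neg_right] at hs ht
  have hamgm : a * (C * r * ‖x - y‖) ≤ C / 2 * (a * r ^ 2) + C / 2 * (a * ‖x - y‖ ^ 2) := by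
    have := mul_nonneg (mul_nonneg ha hC) (sq_nonneg (r - ‖x - y‖))
    nlinarith
  linarith

lemma H2.exists_tendsto {Q : ImpulseData d M 𝒵} {κ₀ : ℝ} (h2 : H2 Q κ₀) (i : Fin M)
    {f : Ultrafilter ℕ} {ξ η : ℕ → E d} {x₀ : E d} (hξ : Tendsto ξ f (𝓝 x₀))
    (hη : Tendsto η f (𝓝 x₀)) {z : ℕ → 𝒵} (hz : ∀ᶠ n in (f : Filter ℕ), z n ∈ Q.Z i (η n)) :
    ∃ z₀, Tendsto z f (𝓝 z₀) ∧ ∃ z' : ℕ → 𝒵, (∀ n, z' n ∈ Q.Z i (ξ n)) ∧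
      Tendsto z' f (𝓝 z₀) := by
  obtain ⟨-, hZ, -, -, hcont, -⟩ := h2
  have hfin : ∀ x y, Metric.hausdorffEDist (Q.Z i x) (Q.Z i y) ≠ ⊤ := fun x y =>
    Metric.hausdorffEDist_ne_top_of_nonempty_of_bounded (hZ i x).1 (hZ i y).1
      (hZ i x).2.isBounded (hZ i y).2.isBounded
  have hdist : ∀ y : ℕ → E d, Tendsto y f (𝓝 x₀) →
      Tendsto (fun n => Metric.hausdorffDist (Q.Z i x₀) (Q.Z i (y n))) f (𝓝 0) := by
    intro y hy
    rw [Metric.tendsto_nhds]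
    intro ε hε
    obtain ⟨r, hr, h⟩ := hcont i x₀ ε hε
    filter_upwards [(Metric.tendsto_nhds.1 hy) r hr] with n hn
    rw [Real.dist_eq, sub_zero, abs_of_nonneg Metric.hausdorffDist_nonneg]
    exact h _ hn
  choose q hq hqdist using fun n => (hZ i x₀).2.exists_infDist_eq_dist (hZ i x₀).1 (z n)
  obtain ⟨z₀, hz₀, hqz⟩ := (hZ i x₀).2.ultrafilter_le_nhds (f.map q)
    (Filter.le_principal_iff.2 (Filter.Eventually.of_forall hq : ∀ᶠ n in (f : Filter ℕ), _))
  have hqz' : Tendsto q f (𝓝 z₀) := hqz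
  have hzq : Tendsto (fun n => dist (q n) (z n)) f (𝓝 0) := by
    refine squeeze_zero' (Eventually.of_forall fun n => dist_nonneg) ?_ (hdist η hη)
    filter_upwards [hz] with n hn
    rw [dist_comm, ← hqdist, Metric.hausdorffDist_comm]
    exact Metric.infDist_le_hausdorffDist_of_mem hn (hfin _ _)
  choose z' hz' hz'dist using fun n => (hZ i (ξ n)).2.exists_infDist_eq_dist (hZ i (ξ n)).1 z₀
  refine ⟨z₀, hqz'.congr_dist hzq, z', hz', ?_⟩
  rw [tendsto_iff_dist_tendsto_zero]
  refine squeeze_zero (fun n => dist_nonneg) (fun n => ?_) (hdist ξ hξ)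
  rw [dist_comm, ← hz'dist]
  exact Metric.infDist_le_hausdorffDist_of_mem hz₀ (hfin _ _)

/-- Comparison when the subsolution inequalities hold with a positive margin. -/
lemma le_of_strict_jets {P : HJBData d d' M 𝒜} {Q : ImpulseData d M 𝒵} {C lam0 κ₀ R ρ : ℝ}
    (h1 : H1 P C lam0) (h2 : H2 Q κ₀) {w v : Fin M → E d → ℝ}
    (hw : ∀ j, UpperSemicontinuous (w j)) (hv : ∀ j, LowerSemicontinuous (v j))
    (hR : ∀ j x, |w j x| ≤ R) (hR' : ∀ j x, |v j x| ≤ R) (hρ : 0 < ρ)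
    (hsub : ∀ i ξ p B, HasUpperJet (w i) ξ p B →
      (∀ α ∈ P.A i, P.formL i α ξ (fun j => w j ξ) p B ≤ -ρ) ∧
        ∀ z ∈ Q.Z i ξ, w i ξ ≤ w i (Q.Γ i ξ z) + Q.K i ξ z - ρ)
    (hsup : ∀ i η p B, HasUpperJet (fun x => -v i x) η p B → ∀ τ > 0,
      (∃ α ∈ P.A i, -τ ≤ P.formL i α η (fun j => v j η) (-p) (-B)) ∨
        ∃ z ∈ Q.Z i η, v i (Q.Γ i η z) + Q.K i η z ≤ v i η + τ)
    (j : Fin M) (x : E d) : w j x ≤ v j x := by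
  by_contra hlt
  rw [not_le] at hlt
  have : Nonempty (Fin M) := ⟨j⟩
  have hv' : ∀ j, UpperSemicontinuous fun x => -v j x := fun j => (hv j).neg
  have hRn : ∀ j x, |-v j x| ≤ R := fun j x => by rw [abs_neg]; exact hR' j x
  have hR0 : 0 ≤ R := (abs_nonneg _).trans (hR j x)
  set D : Fin M × E d → ℝ := fun q => w q.1 q.2 - v q.1 q.2 with hD
  have hDle : ∀ q, D q ≤ 2 * R := fun q => by
    have e1 := (abs_le.1 (hR q.1 q.2)).2
    have e2 := (abs_le.1 (hR' q.1 q.2)).1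
    simp only [hD]
    linarith
  have hDb : BddAbove (Set.range D) := ⟨2 * R, by rintro _ ⟨q, rfl⟩; exact hDle q⟩
  set m := ⨆ q, D q with hm
  have hDm : ∀ q, D q ≤ m := le_ciSup hDb
  have hm0 : 0 < m := lt_of_lt_of_le (sub_pos.2 hlt) (hDm (j, x))
  obtain ⟨⟨j₁, x₁⟩, h₁⟩ := exists_lt_of_lt_ciSup
    (show max (m - ρ) 0 < ⨆ q, D q from max_lt (by linarith) hm0)
  set gap := D (j₁, x₁) - max (m - ρ) 0 with hgap
  have hgap0 : 0 < gap := sub_pos.2 h₁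
  set Λ := C ^ 2 + 4 * C ^ 2 / ρ * (2 * R) with hΛ
  have hΛ0 : 0 ≤ Λ := by positivity
  obtain ⟨δ, hδ, hδΛ, hδgap⟩ : ∃ δ > 0, δ * Λ ≤ ρ / 4 ∧ δ * ‖x₁‖ ^ 2 < gap := by
    refine ⟨min (ρ / 4 / (Λ + 1)) (gap / (‖x₁‖ ^ 2 + 1)), by positivity, ?_, ?_⟩
    · refine (mul_le_mul_of_nonneg_right (min_le_left _ _) hΛ0).trans ?_
      rw [div_mul_eq_mul_div, div_le_iff₀ (by positivity)]
      nlinarith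
    · refine (mul_le_mul_of_nonneg_right (min_le_right _ _) (sq_nonneg _)).trans_lt ?_
      rw [div_mul_eq_mul_div, div_lt_iff₀ (by positivity)]
      nlinarith
  set N : Fin M × E d → ℝ := fun q => D q - δ * ‖q.2‖ ^ 2 with hN
  have hNb : BddAbove (Set.range N) := by
    refine ⟨2 * R, ?_⟩
    rintro _ ⟨q, rfl⟩
    have : 0 ≤ δ * ‖q.2‖ ^ 2 := by positivity
    simp only [hN]
    linarith [hDle q]
  set μ := ⨆ q, N q with hμ
  have hNμ : ∀ q, N q ≤ μ := le_ciSup hNb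
  have hμgt : max (m - ρ) 0 < μ := lt_of_lt_of_le (by simp only [hN]; linarith) (hNμ (j₁, x₁))
  have hμ0 : 0 < μ := (le_max_right _ _).trans_lt hμgt
  have hμρ : m - ρ < μ := (le_max_left _ _).trans_lt hμgt
  set a : ℕ → ℝ := fun n => n + 1 with ha_def
  set τ : ℕ → ℝ := fun n => 1 / ((n : ℝ) + 1) with hτ_def
  have ha : ∀ n, 0 < a n := fun n => by positivity
  have hτ : ∀ n, 0 < τ n := fun n => by positivity
  choose i ξ η y y' p p' B B' hmax hj hj' hp hp' hB using fun n =>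
    exists_doubled_jets_system hw hv' hR hRn (ha n) hδ (hτ n)
  have hμmax : ∀ n, μ - τ n ≤ doubled (w (i n)) (fun x => -v (i n) x) (a n) δ
      (ξ n) (η n) (y n) (y' n) := by
    intro n
    rw [sub_le_iff_le_add]
    refine ciSup_le fun q => ?_
    have h := hmax n q.1 q.2 q.2 q.2 q.2
    refine le_trans (le_of_eq ?_) h
    simp [doubled, hN, hD]
    ring
  have hval : ∀ n, μ - τ n + δ * ‖y n‖ ^ 2 ≤ w (i n) (ξ n) - v (i n) (η n) := by
    intro n
    have h := hμmax n
    unfold doubled at h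
    have e1 := mul_nonneg (half_pos (ha n)).le (sq_nonneg ‖y n - ξ n‖)
    have e2 := mul_nonneg (half_pos (ha n)).le (sq_nonneg ‖y' n - η n‖)
    have e3 := mul_nonneg (half_pos (ha n)).le (sq_nonneg ‖y n - y' n‖)
    linarith
  have hcmp : ∀ n j, w j (ξ n) - v j (η n) ≤ w (i n) (ξ n) - v (i n) (η n) + τ n := by
    intro n j
    have h := hmax n j (ξ n) (η n) (y n) (y' n)
    unfold doubled at h
    linarith
  set f : Ultrafilter ℕ := Filter.hyperfilter ℕ with hf
  have hfle : (f : Filter ℕ) ≤ atTop := by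
    rw [← Nat.cofinite_eq_atTop]
    exact Filter.hyperfilter_le_cofinite
  obtain ⟨k, hk⟩ : ∃ k, ∀ᶠ n in (f : Filter ℕ), i n = k := by
    obtain ⟨k, -, hk⟩ := isCompact_univ.ultrafilter_le_nhds (f.map i) (by simp)
    rw [nhds_discrete] at hk
    exact ⟨k, Filter.le_pure_iff.1 hk⟩
  have haf : Tendsto a f atTop :=
    (tendsto_atTop_add_const_right _ _ tendsto_natCast_atTop_atTop).mono_left hfle
  have hτf : Tendsto τ f (𝓝 0) := tendsto_one_div_add_atTop_nhds_zero_nat.mono_left hfle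
  obtain ⟨x₀, hξ, hη, hr, hs⟩ := doubled_limit (hw k) (hv' k) (hR k) (hRn k) hδ
    (fun x => by simpa [hN, hD, sub_eq_add_neg] using hNμ (k, x)) haf hτf
    (hk.mono fun n hn => by have := hμmax n; rwa [hn] at this)
  have hbranch := Eventually.of_forall (f := (f : Filter ℕ)) fun n =>
    hsup _ _ _ _ (hj' n) (τ n) (hτ n)
  rw [Ultrafilter.eventually_or] at hbranch
  rcases hbranch with hA | hZ
  · have hr' : Tendsto (fun n => ‖ξ n - η n‖) f (𝓝 0) := by
      simpa using (hξ.sub hη).norm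
    have hlim : Tendsto (fun n => ρ / 2 + (2 * (C ^ 2 / ρ) * (4 / 2)) * (δ * τ n)
        + (1 + C ^ 2 + 2 * C + M * C) * τ n
        + (C ^ 2 / 2 + C / 2) * (a n * ‖ξ n - η n‖ ^ 2) + C / 2 * (a n * ‖y n - y' n‖ ^ 2)
        + ((M + 1) * C * R + C) * ‖ξ n - η n‖) f (𝓝 (ρ / 2)) := by
      have := (((((hτf.const_mul δ).const_mul (2 * (C ^ 2 / ρ) * (4 / 2))).const_add (ρ / 2)).add
        (hτf.const_mul (1 + C ^ 2 + 2 * C + M * C))).add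
        (hr.const_mul (C ^ 2 / 2 + C / 2))).add (hs.const_mul (C / 2))
      simpa using this.add (hr'.const_mul ((M + 1) * C * R + C))
    have hle : ρ ≤ ρ / 2 := by
      refine ge_of_tendsto hlim ?_
      filter_upwards [hA, hτf.eventually_lt_const hμ0] with n ⟨α, hα, hsuper⟩ hn
      have h0 := hval n
      have hsq : 0 ≤ δ * ‖y n‖ ^ 2 := by positivity
      have hgap_n := h1.gap_le hα (ha n).le hδ.le (hτ n).le ((hsub _ _ _ _ (hj n)).1 α hα) hsuper
        (fun j => hR' j _) (hcmp n) (by linarith) (hp n) (hp' n) (hB n)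
      have hDn : w (i n) (ξ n) - v (i n) (η n) ≤ 2 * R := by
        have e1 := (abs_le.1 (hR (i n) (ξ n))).2
        have e2 := (abs_le.1 (hR' (i n) (η n))).1
        linarith
      have hyb : δ * ‖y n‖ ^ 2 ≤ 2 * R + τ n := by linarith
      have hsmall : 2 * C * (δ * ‖y n‖) ≤ ρ / 4 + 4 * C ^ 2 / ρ * (δ * (2 * R + τ n)) := by
        have e1 : 2 * C * (δ * ‖y n‖) ≤ ρ / 4 + 4 * C ^ 2 / ρ * (δ * ‖y n‖) ^ 2 := by
          have e : ρ / 4 + 4 * C ^ 2 / ρ * (δ * ‖y n‖) ^ 2 - 2 * C * (δ * ‖y n‖)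
              = (ρ / 2 - 2 * C * (δ * ‖y n‖)) ^ 2 / ρ := by
            field_simp
            ring
          have : 0 ≤ (ρ / 2 - 2 * C * (δ * ‖y n‖)) ^ 2 / ρ := by positivity
          linarith
        have e2 : (δ * ‖y n‖) ^ 2 ≤ δ * (2 * R + τ n) := by
          rw [mul_pow, pow_two δ, mul_assoc]
          exact mul_le_mul_of_nonneg_left hyb hδ.le
        exact e1.trans (add_le_add_right (mul_le_mul_of_nonneg_left e2 (by positivity)) _)
      have e3 : δ * C ^ 2 + 4 * C ^ 2 / ρ * (δ * (2 * R + τ n))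
          = δ * Λ + 4 * C ^ 2 / ρ * (δ * τ n) := by
        rw [hΛ]
        ring
      have e4 : 2 * (C ^ 2 / ρ) * (4 / 2) * (δ * τ n) = 4 * C ^ 2 / ρ * (δ * τ n) := by ring
      linarith
    linarith
  · have hZ' : ∀ᶠ n in (f : Filter ℕ), ∃ z ∈ Q.Z k (η n),
        v k (Q.Γ k (η n) z) + Q.K k (η n) z ≤ v k (η n) + τ n := by
      filter_upwards [hZ, hk] with n hn hkn
      rwa [hkn] at hn
    obtain ⟨z, hz⟩ := hZ'.choice
    obtain ⟨z₀, hzz, z', hz', hzz'⟩ := h2.exists_tendsto k hξ hη (hz.mono fun n h => h.1)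
    obtain ⟨-, -, hΓ, hK, -⟩ := h2
    have hpair := hξ.prodMk_nhds hzz'
    have hpair' := hη.prodMk_nhds hzz
    have hΓξ : Tendsto (fun n => Q.Γ k (ξ n) (z' n)) f (𝓝 (Q.Γ k x₀ z₀)) :=
      ((hΓ k).tendsto (x₀, z₀)).comp hpair
    have hΓη : Tendsto (fun n => Q.Γ k (η n) (z n)) f (𝓝 (Q.Γ k x₀ z₀)) :=
      ((hΓ k).tendsto (x₀, z₀)).comp hpair'
    have hKξ : Tendsto (fun n => Q.K k (ξ n) (z' n)) f (𝓝 (Q.K k x₀ z₀)) :=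
      ((hK k).tendsto (x₀, z₀)).comp hpair
    have hKη : Tendsto (fun n => Q.K k (η n) (z n)) f (𝓝 (Q.K k x₀ z₀)) :=
      ((hK k).tendsto (x₀, z₀)).comp hpair'
    set ε := (μ - (m - ρ)) / 7 with hε
    have hε0 : 0 < ε := by
      rw [hε]
      linarith
    have hev := (hk.and hz).and <| (hτf.eventually_lt_const hε0).and <|
      (hΓξ.eventually (hw k _ (w k (Q.Γ k x₀ z₀) + ε) (by linarith))).and <|
      (hΓη.eventually (hv' k _ (-v k (Q.Γ k x₀ z₀) + ε) (by linarith))).and <|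
      (hKξ.eventually_lt_const (by linarith : Q.K k x₀ z₀ < Q.K k x₀ z₀ + ε)).and
      (hKη.eventually_const_lt (by linarith : Q.K k x₀ z₀ - ε < Q.K k x₀ z₀))
    obtain ⟨n, ⟨hkn, -, hzn⟩, e1, e2, e3, e4, e5⟩ := hev.exists
    have h3 := hval n
    have h4 := (hsub _ _ _ _ (hj n)).2
    rw [hkn] at h3 h4
    have h5 := h4 (z' n) (hz' n)
    have h6 := hDm (k, Q.Γ k x₀ z₀)
    simp only [hD] at h6
    have h7 : 0 ≤ δ * ‖y n‖ ^ 2 := by positivity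
    linarith

lemma strict_jets_of_subsolution {P : HJBData d d' M 𝒜} {Q : ImpulseData d M 𝒵}
    {C lam0 κ₀ θ : ℝ} (h1 : H1 P C lam0) (h2 : H2 Q κ₀) {u : Fin M → E d → ℝ} (hub : Bdd u)
    (hsub : IsSubsolution (Fqvi P Q) u) (hθ : 0 < θ) (hθ1 : θ < 1) {i : Fin M} {ξ p : E d}
    {B : E d →L[ℝ] E d}
    (hj : HasUpperJet (fun x => θ * u i x - (C + 1) / lam0 * (1 - θ)) ξ p B) :
    (∀ α ∈ P.A i, P.formL i α ξ (fun j => θ * u j ξ - (C + 1) / lam0 * (1 - θ)) p B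
        ≤ -((1 - θ) * min 1 κ₀)) ∧
      ∀ z ∈ Q.Z i ξ, θ * u i ξ - (C + 1) / lam0 * (1 - θ)
        ≤ θ * u i (Q.Γ i ξ z) - (C + 1) / lam0 * (1 - θ) + Q.K i ξ z
          - (1 - θ) * min 1 κ₀ := by
  set k := (C + 1) / lam0 * (1 - θ) with hk
  have hju : HasUpperJet (u i) ξ (θ⁻¹ • p) (θ⁻¹ • B) := by
    have h := hj.const_mul_add (inv_pos.2 hθ) (θ⁻¹ * k)
    convert h using 1
    ext x
    field_simp
    ring
  have h := subsolution_of_jet h1 h2 hub hsub hju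
  have hθ' : 0 < 1 - θ := sub_pos.2 hθ1
  refine ⟨fun α hα => ?_, fun z hz => ?_⟩
  · have hu := mul_le_mul_of_nonneg_left (h.1 α hα) hθ.le
    obtain ⟨-, -, -, -, -, -, -, -, -, -, -, hl, -, -, -, hlam⟩ := h1.2.2 i α hα
    have hC : 0 ≤ C := (abs_nonneg _).trans (hl ξ)
    have hlam0 := h1.1
    have hk0 : 0 ≤ k := by positivity
    have e1 := mul_le_mul_of_nonneg_right (hlam ξ) hk0
    have e2 : lam0 * k = (C + 1) * (1 - θ) := by
      rw [hk]
      field_simp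
    have e3 := mul_le_mul_of_nonneg_left ((neg_le_abs _).trans (hl ξ)) hθ'.le
    have e4 : (1 - θ) * min 1 κ₀ ≤ (1 - θ) * 1 :=
      mul_le_mul_of_nonneg_left (min_le_left _ _) hθ'.le
    have e5 : P.formL i α ξ (fun j => θ * u j ξ - k) p B
        = θ * P.formL i α ξ (fun j => u j ξ) (θ⁻¹ • p) (θ⁻¹ • B)
          - (P.cz i α ξ - ∑ j ∈ Finset.univ.erase i, P.dcp i j α ξ) * k
          - (1 - θ) * P.runCost i α ξ := by
      have e6 : ∑ j ∈ Finset.univ.erase i, P.dcp i j α ξ * (θ * u j ξ - k)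
          = θ * ∑ j ∈ Finset.univ.erase i, P.dcp i j α ξ * u j ξ
            - (∑ j ∈ Finset.univ.erase i, P.dcp i j α ξ) * k := by
        rw [Finset.mul_sum, Finset.sum_mul, ← Finset.sum_sub_distrib]
        exact Finset.sum_congr rfl fun j _ => by ring
      simp only [HJBData.formL, formTrace_smul, inner_smul_right, e6]
      field_simp
      ring
    rw [e5]
    linarith
  · have hu := mul_le_mul_of_nonneg_left (h.2 z hz) hθ.le
    have e1 := mul_le_mul_of_nonneg_left
      ((min_le_right 1 κ₀).trans (h2.2.2.2.2.2 i ξ z hz)) hθ'.le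
    linarith

/-- Comparison principle for the HJBQVI system: under (H.1) and (H.2),
any bounded viscosity subsolution lies below any bounded viscosity supersolution. -/
theorem comparison_principle_HJBQVI
    {d d' M : ℕ} {𝒜 𝒵 : Type} [MetricSpace 𝒜] [MetricSpace 𝒵]
    (P : HJBData d d' M 𝒜) (Q : ImpulseData d M 𝒵) (C lam0 κ₀ : ℝ)
    (h1 : H1 P C lam0) (h2 : H2 Q κ₀)
    (u v : Fin M → E d → ℝ) (hub : Bdd u) (hvb : Bdd v)
    (hsub : IsSubsolution (Fqvi P Q) u) (hsup : IsSupersolution (Fqvi P Q) v) :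
    ∀ (i : Fin M) (x : E d), u i x ≤ v i x := by
  obtain ⟨U, hU⟩ := hub
  obtain ⟨V, hV⟩ := hvb
  intro i x
  set k := (C + 1) / lam0 with hk
  have hstrict : ∀ θ ∈ Set.Ioo (0 : ℝ) 1, θ * u i x - k * (1 - θ) ≤ v i x := by
    rintro θ ⟨hθ, hθ1⟩
    have hU0 : 0 ≤ U := (abs_nonneg _).trans (hU i x)
    have hV0 : 0 ≤ V := (abs_nonneg _).trans (hV i x)
    refine le_of_strict_jets (R := U + V + |k|) (ρ := (1 - θ) * min 1 κ₀) h1 h2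
      (w := fun j x => θ * u j x - k * (1 - θ)) (fun j y c hc => ?_) hsup.1 (fun j y => ?_)
      (fun j y => ?_) (mul_pos (sub_pos.2 hθ1) (lt_min one_pos h2.1))
      (fun j ξ p B hj => strict_jets_of_subsolution h1 h2 ⟨U, hU⟩ hsub hθ hθ1 hj)
      (fun j η p B hj τ hτ => supersolution_of_jet h1 h2 hsup hj hτ) i x
    · have h : u j y < (c + k * (1 - θ)) / θ := by
        rw [lt_div_iff₀ hθ]
        linarith
      filter_upwards [hsub.1 j y _ h] with y' hy'
      rw [lt_div_iff₀ hθ] at hy'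
      linarith
    · refine (abs_sub _ _).trans ?_
      rw [abs_mul, abs_mul, abs_of_pos hθ, abs_of_pos (sub_pos.2 hθ1)]
      have e1 := mul_le_mul hθ1.le (hU j y) (abs_nonneg _) zero_le_one
      have e2 := mul_le_mul_of_nonneg_left (by linarith : 1 - θ ≤ 1) (abs_nonneg k)
      linarith
    · linarith [hV j y, abs_nonneg k]
  have hlim : Tendsto (fun θ : ℝ => θ * u i x - k * (1 - θ)) (𝓝[<] 1) (𝓝 (u i x)) := by
    have h : Continuous fun θ : ℝ => θ * u i x - k * (1 - θ) := by fun_prop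
    simpa using (h.tendsto 1).mono_left nhdsWithin_le_nhds
  exact le_of_tendsto hlim (Filter.mem_of_superset
    (Ioo_mem_nhdsLT (zero_lt_one' ℝ)) hstrict)

end HJBQVI
end
end

section
/- Stability of the intervention operator under half-relaxed limits: assume (H.2), and let (u^ρ)_{ρ∈ℕ} be a family of uniformly bounded ℝ^M-valued functions on ℝ^d with half-relaxed limits u*(x) := limsup_{ρ→∞, y→x} u^ρ(y) and u_*(x) := liminf_{ρ→∞, y→x} u^ρ(y) (componentwise). Then for every i ∈ ℐ, every x ∈ ℝ^d and every sequence (x^ρ)_{ρ∈ℕ} with x^ρ → x, one has (M_i u_*)(x) ≤ liminf_{ρ→∞} (M_i u^ρ)(x^ρ) ≤ limsup_{ρ→∞} (M_i u^ρ)(x^ρ) ≤ (M_i u*)(x). -/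
noncomputable section
open scoped BigOperators RealInnerProductSpace
open Filter Topology Matrix

namespace HJBQVI

variable {d d' M : ℕ}

variable {𝒜 𝒵 : Type} [MetricSpace 𝒜] [MetricSpace 𝒵]

lemma eventually_exists_mem_of_hausdorffDist {α X : Type*} [MetricSpace X] {l : Filter α}
    {S : Set X} {T : α → Set X} (hfin : ∀ a, Metric.hausdorffEDist S (T a) ≠ ⊤)
    (hT : ∀ ε > (0 : ℝ), ∀ᶠ a in l, Metric.hausdorffDist S (T a) < ε)
    {z : X} (hz : z ∈ S) {p : α × X → Prop} (hp : ∀ᶠ q in l ×ˢ 𝓝 z, p q) :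
    ∀ᶠ a in l, ∃ y ∈ T a, p (a, y) := by
  obtain ⟨pa, ha, pz, hz', h⟩ := eventually_prod_iff.1 hp
  obtain ⟨ε, hε, hball⟩ := Metric.eventually_nhds_iff.1 hz'
  filter_upwards [ha, hT ε hε] with a h1 h2
  obtain ⟨y, hy, hd⟩ := Metric.exists_dist_lt_of_hausdorffDist_lt hz h2 (hfin a)
  exact ⟨y, hy, h h1 (hball (by rwa [dist_comm]))⟩

lemma eventually_forall_mem_of_hausdorffDist {α X : Type*} [MetricSpace X] {l : Filter α}
    {S : Set X} {T : α → Set X} (hS : IsCompact S)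
    (hfin : ∀ a, Metric.hausdorffEDist S (T a) ≠ ⊤)
    (hT : ∀ ε > (0 : ℝ), ∀ᶠ a in l, Metric.hausdorffDist S (T a) < ε)
    {p : α × X → Prop} (hp : ∀ z ∈ S, ∀ᶠ q in l ×ˢ 𝓝 z, p q) :
    ∀ᶠ a in l, ∀ y ∈ T a, p (a, y) := by
  have hp' : ∀ᶠ q in l ×ˢ 𝓝ˢ S, p q := by
    rw [hS.prod_nhdsSet_eq_biSup]
    simpa only [eventually_iSup] using hp
  obtain ⟨pa, ha, pz, hz', h⟩ := eventually_prod_iff.1 hp'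
  obtain ⟨ε, hε, hthick⟩ := (Metric.hasBasis_nhdsSet_thickening hS).eventually_iff.1 hz'
  filter_upwards [ha, hT ε hε] with a h1 h2 y hy
  obtain ⟨z, hz, hd⟩ := Metric.exists_dist_lt_of_hausdorffDist_lt' hy h2 (hfin a)
  exact h h1 (hthick (Metric.mem_thickening_iff.2 ⟨z, hz, by rwa [dist_comm]⟩))

lemma eventually_lt_of_relaxSup_lt {d : ℕ} {u : ℕ → E d → ℝ} {B : ℝ}
    (hB : ∀ ρ x, |u ρ x| ≤ B) {x : E d} {c : ℝ} (h : relaxSup u x < c) :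
    ∀ᶠ p in atTop ×ˢ 𝓝 x, u p.1 p.2 < c :=
  eventually_lt_of_limsup_lt h (isBoundedUnder_of ⟨B, fun p => (abs_le.1 (hB p.1 p.2)).2⟩)

lemma eventually_lt_of_lt_relaxInf {d : ℕ} {u : ℕ → E d → ℝ} {B : ℝ}
    (hB : ∀ ρ x, |u ρ x| ≤ B) {x : E d} {c : ℝ} (h : c < relaxInf u x) :
    ∀ᶠ p in atTop ×ˢ 𝓝 x, c < u p.1 p.2 :=
  eventually_lt_of_lt_liminf h (isBoundedUnder_of ⟨-B, fun p => (abs_le.1 (hB p.1 p.2)).1⟩)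

lemma neg_le_relaxInf {d : ℕ} {u : ℕ → E d → ℝ} {B : ℝ}
    (hB : ∀ ρ x, |u ρ x| ≤ B) (x : E d) : -B ≤ relaxInf u x :=
  le_liminf_of_le
    (isBoundedUnder_of ⟨B, fun p : ℕ × E d => (abs_le.1 (hB p.1 p.2)).2⟩ :
      IsBoundedUnder (· ≤ ·) _ _).isCoboundedUnder_ge
    (Eventually.of_forall fun p => (abs_le.1 (hB p.1 p.2)).1)

section Intervention

variable {d M : ℕ} {𝒵 : Type} [MetricSpace 𝒵] {Q : ImpulseData d M 𝒵} {κ₀ : ℝ}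

lemma H2.add_le (h2 : H2 Q κ₀) {u : Fin M → E d → ℝ} {b : ℝ} {i : Fin M}
    (hb : ∀ x, b ≤ u i x) {x : E d} {z : 𝒵} (hz : z ∈ Q.Z i x) :
    b + κ₀ ≤ u i (Q.Γ i x z) + Q.K i x z :=
  add_le_add (hb _) (h2.2.2.2.2.2 i x z hz)

lemma H2.le_Mop (h2 : H2 Q κ₀) {u : Fin M → E d → ℝ} {i : Fin M} {x : E d} {c : ℝ}
    (hc : ∀ z ∈ Q.Z i x, c ≤ u i (Q.Γ i x z) + Q.K i x z) : c ≤ Q.Mop i u x :=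
  le_csInf ((h2.2.1 i x).1.image _) (Set.forall_mem_image.2 hc)

lemma H2.Mop_le (h2 : H2 Q κ₀) {u : Fin M → E d → ℝ} {b : ℝ} {i : Fin M}
    (hb : ∀ x, b ≤ u i x) {x : E d} {z : 𝒵} (hz : z ∈ Q.Z i x) :
    Q.Mop i u x ≤ u i (Q.Γ i x z) + Q.K i x z :=
  csInf_le ⟨b + κ₀, Set.forall_mem_image.2 fun _ hw => h2.add_le hb hw⟩
    (Set.mem_image_of_mem _ hz)

lemma H2.hausdorffEDist_ne_top (h2 : H2 Q κ₀) (i : Fin M) (x y : E d) :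
    Metric.hausdorffEDist (Q.Z i x) (Q.Z i y) ≠ ⊤ :=
  Metric.hausdorffEDist_ne_top_of_nonempty_of_bounded (h2.2.1 i x).1 (h2.2.1 i y).1
    (h2.2.1 i x).2.isBounded (h2.2.1 i y).2.isBounded

lemma H2.eventually_hausdorffDist_lt (h2 : H2 Q κ₀) (i : Fin M) {x : E d} {xs : ℕ → E d}
    (hxs : Tendsto xs atTop (𝓝 x)) {ε : ℝ} (hε : 0 < ε) :
    ∀ᶠ ρ in atTop, Metric.hausdorffDist (Q.Z i x) (Q.Z i (xs ρ)) < ε := by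
  obtain ⟨δ, hδ, h⟩ := h2.2.2.2.2.1 i x ε hε
  filter_upwards [hxs.eventually (Metric.ball_mem_nhds x hδ)] with ρ hρ
  exact h _ hρ

lemma H2.tendsto_Γ (h2 : H2 Q κ₀) (i : Fin M) {x : E d} {xs : ℕ → E d}
    (hxs : Tendsto xs atTop (𝓝 x)) (z : 𝒵) :
    Tendsto (fun p : ℕ × 𝒵 => (p.1, Q.Γ i (xs p.1) p.2)) (atTop ×ˢ 𝓝 z)
      (atTop ×ˢ 𝓝 (Q.Γ i x z)) :=
  tendsto_fst.prodMk (((h2.2.2.1 i).tendsto (x, z)).comp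
    ((hxs.comp tendsto_fst).prodMk_nhds tendsto_snd))

lemma H2.tendsto_K (h2 : H2 Q κ₀) (i : Fin M) {x : E d} {xs : ℕ → E d}
    (hxs : Tendsto xs atTop (𝓝 x)) (z : 𝒵) :
    Tendsto (fun p : ℕ × 𝒵 => Q.K i (xs p.1) p.2) (atTop ×ˢ 𝓝 z) (𝓝 (Q.K i x z)) :=
  ((h2.2.2.2.1 i).tendsto (x, z)).comp
    ((hxs.comp tendsto_fst).prodMk_nhds tendsto_snd)

variable {u : ℕ → Fin M → E d → ℝ} {B : ℝ} {i : Fin M} {x : E d} {xs : ℕ → E d}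

lemma H2.eventually_Mop_lt (h2 : H2 Q κ₀) (hB : ∀ ρ i x, |u ρ i x| ≤ B)
    (hxs : Tendsto xs atTop (𝓝 x)) {z : 𝒵} (hz : z ∈ Q.Z i x) {c : ℝ}
    (hc : relaxSup (fun ρ => u ρ i) (Q.Γ i x z) + Q.K i x z < c) :
    ∀ᶠ ρ in atTop, Q.Mop i (u ρ) (xs ρ) < c := by
  obtain ⟨a, ha, hac⟩ := exists_between (lt_sub_iff_add_lt.2 hc)
  have hu := (h2.tendsto_Γ i hxs z).eventually
    (eventually_lt_of_relaxSup_lt (fun ρ => hB ρ i) ha)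
  have hK := (h2.tendsto_K i hxs z).eventually_lt_const (lt_sub_comm.1 hac)
  filter_upwards [eventually_exists_mem_of_hausdorffDist (fun ρ => h2.hausdorffEDist_ne_top i x _)
    (fun ε hε => h2.eventually_hausdorffDist_lt i hxs hε) hz (hu.and hK)]
    with ρ ⟨y, hy, huy, hKy⟩
  have := h2.Mop_le (u := u ρ) (fun w => (abs_le.1 (hB ρ i w)).1) hy
  linarith

lemma H2.eventually_le_Mop (h2 : H2 Q κ₀) (hB : ∀ ρ i x, |u ρ i x| ≤ B)
    (hxs : Tendsto xs atTop (𝓝 x)) {c : ℝ}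
    (hc : c < Q.Mop i (fun j y => relaxInf (fun ρ => u ρ j) y) x) :
    ∀ᶠ ρ in atTop, c ≤ Q.Mop i (u ρ) (xs ρ) := by
  have key : ∀ z ∈ Q.Z i x, ∀ᶠ p in atTop ×ˢ 𝓝 z,
      c ≤ u p.1 i (Q.Γ i (xs p.1) p.2) + Q.K i (xs p.1) p.2 := by
    intro z hz
    have hcz := hc.trans_le
      (h2.Mop_le (fun w => neg_le_relaxInf (fun ρ => hB ρ i) w) hz)
    obtain ⟨a, hca, ha⟩ := exists_between (sub_lt_iff_lt_add.2 hcz)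
    filter_upwards [(h2.tendsto_Γ i hxs z).eventually
      (eventually_lt_of_lt_relaxInf (fun ρ => hB ρ i) ha),
      (h2.tendsto_K i hxs z).eventually_const_lt (sub_lt_comm.1 hca)] with p hu hK
    linarith
  filter_upwards [eventually_forall_mem_of_hausdorffDist (h2.2.1 i x).2
    (fun ρ => h2.hausdorffEDist_ne_top i x _)
    (fun ε hε => h2.eventually_hausdorffDist_lt i hxs hε) key] with ρ hρ
  exact h2.le_Mop hρ

end Intervention

/-- Stability of the intervention operator under half-relaxed limits. -/
theorem intervention_halfRelaxedLimits
    {d M : ℕ} {𝒵 : Type} [MetricSpace 𝒵]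
    (Q : ImpulseData d M 𝒵) (κ₀ : ℝ) (h2 : H2 Q κ₀)
    (u : ℕ → Fin M → E d → ℝ) (B : ℝ) (hB : ∀ ρ i x, |u ρ i x| ≤ B)
    (i : Fin M) (x : E d) (xs : ℕ → E d)
    (hxs : Filter.Tendsto xs Filter.atTop (nhds x)) :
    Q.Mop i (fun j y => relaxInf (fun ρ => u ρ j) y) x ≤
        Filter.liminf (fun ρ => Q.Mop i (u ρ) (xs ρ)) Filter.atTop ∧
    Filter.liminf (fun ρ => Q.Mop i (u ρ) (xs ρ)) Filter.atTop ≤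
        Filter.limsup (fun ρ => Q.Mop i (u ρ) (xs ρ)) Filter.atTop ∧
    Filter.limsup (fun ρ => Q.Mop i (u ρ) (xs ρ)) Filter.atTop ≤
        Q.Mop i (fun j y => relaxSup (fun ρ => u ρ j) y) x := by
  obtain ⟨z₀, hz₀⟩ := (h2.2.1 i x).1
  have hle : IsBoundedUnder (· ≤ ·) atTop fun ρ => Q.Mop i (u ρ) (xs ρ) :=
    isBoundedUnder_of_eventually_le
      ((h2.eventually_Mop_lt hB hxs hz₀ (lt_add_one _)).mono fun _ h => h.le)
  have hge : IsBoundedUnder (· ≥ ·) atTop fun ρ => Q.Mop i (u ρ) (xs ρ) :=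
    isBoundedUnder_of_eventually_ge (h2.eventually_le_Mop hB hxs (sub_one_lt _))
  refine ⟨le_of_forall_lt_imp_le_of_dense fun c hc =>
    le_liminf_of_le hle.isCoboundedUnder_ge (h2.eventually_le_Mop hB hxs hc),
    liminf_le_limsup hle hge, h2.le_Mop fun z hz =>
    le_of_forall_gt_imp_ge_of_dense fun c hc => limsup_le_of_le hge.isCoboundedUnder_le
      ((h2.eventually_Mop_lt hB hxs hz hc).mono fun _ h => h.le)⟩
end HJBQVI
end
end
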